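/- arXiv:0911.3940 — 2 statements merged into one kernel-verified Lean document; each statement's English description precedes it below -/
import Mathlib

section
/- Let C_L > C_R, let U be a bounded entropy solution admitting one-sided spatial limits, and let η be smooth with η″ > 0. Then there exists κ with 1 < κ < ∞, depending only on U, A, η, C_L and C_R, such that for every δ > 0 and every interval [t₀,T]: if x_L, x_R : [t₀,T] → ℝ are Filippov solutions of ẋ_L(t) ∈ [f(U(x_L(t)+,t),C_L), f(U(x_L(t)−,t),C_L)] and ẋ_R(t) ∈ [f(U(x_R(t)+,t),C_R), f(U(x_R(t)−,t),C_R)] with x_R(t₀) − x_L(t₀) = δ and x_R(t) − x_L(t) ≥ δ for all t ∈ [t₀,T], then x_R(t) − x_L(t) ≤ κδ for all t ∈ [t₀,T]. -/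
open MeasureTheory Set Filter Topology

noncomputable section

/-- The Riemann data `φ` with left state `CL` and right state `CR`. -/
def riemann (CL CR : ℝ) (x : ℝ) : ℝ := if x < 0 then CL else CR

/-- The relative entropy `η(v | C) = η(v) - η(C) - η'(C)(v - C)`. -/
def relEnt (η : ℝ → ℝ) (v C : ℝ) : ℝ := η v - η C - deriv η C * (v - C)

/-- The relative entropy flux `F(v, C) = ∫_C^v (η'(w) - η'(C)) A'(w) dw`. -/
def relFlux (A η : ℝ → ℝ) (v C : ℝ) : ℝ := ∫ w in C..v, (deriv η w - deriv η C) * deriv A w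

/-- The normalized relative entropy flux `f(v, C) = F(v, C) / η(v | C)` for `v ≠ C`,
extended by `f(C, C) = A'(C)` on the diagonal. -/
def normFlux (A η : ℝ → ℝ) (v C : ℝ) : ℝ :=
  if v = C then deriv A C else relFlux A η v C / relEnt η v C

/-- `U` is a bounded measurable entropy solution of `∂ₜ U + ∂ₓ A(U) = 0` on `ℝ × (0, ∞)`:
for every entropy/entropy-flux pair `(η, G)` with `η'' ≥ 0` and `G' = η' A'`, and every
nonnegative smooth compactly supported test function `θ` vanishing for `t ≤ 0`, one has
`∫₀^∞ ∫_ℝ (η(U) ∂ₜθ + G(U) ∂ₓθ) dx dt ≥ 0`. -/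
structure IsEntropySol (A : ℝ → ℝ) (U : ℝ → ℝ → ℝ) : Prop where
  bounded : ∃ M, ∀ x t, |U x t| ≤ M
  measurable : Measurable fun p : ℝ × ℝ => U p.1 p.2
  entropy : ∀ η G : ℝ → ℝ, ContDiff ℝ (⊤ : ℕ∞) η → ContDiff ℝ (⊤ : ℕ∞) G →
    (∀ v, 0 ≤ deriv (deriv η) v) → (∀ v, deriv G v = deriv η v * deriv A v) →
    ∀ θ : ℝ → ℝ → ℝ, ContDiff ℝ (⊤ : ℕ∞) (fun p : ℝ × ℝ => θ p.1 p.2) →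
      HasCompactSupport (fun p : ℝ × ℝ => θ p.1 p.2) →
      (∀ x t, 0 ≤ θ x t) → (∀ x t, t ≤ 0 → θ x t = 0) →
      0 ≤ ∫ t in Ioi (0 : ℝ), ∫ x : ℝ,
        (η (U x t) * deriv (fun s => θ x s) t + G (U x t) * deriv (fun y => θ y t) x)

/-- `Um x t = U(x-, t)` and `Up x t = U(x+, t)` are the one-sided spatial limits of `U`,
satisfying `U(x-, t) ≥ U(x+, t)` for all `x` and all `t > 0`. -/
structure HasSideLimits (U Um Up : ℝ → ℝ → ℝ) : Prop where
  left : ∀ x t : ℝ, 0 < t → Tendsto (fun y => U y t) (𝓝[<] x) (𝓝 (Um x t))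
  right : ∀ x t : ℝ, 0 < t → Tendsto (fun y => U y t) (𝓝[>] x) (𝓝 (Up x t))
  mono : ∀ x t : ℝ, 0 < t → Up x t ≤ Um x t

/-- `t ↦ U(·, t)` is continuous from `[0, ∞)` into `L¹_loc(ℝ)`. -/
def L1locCont (U : ℝ → ℝ → ℝ) : Prop :=
  ∀ R > (0 : ℝ), ∀ t₀ ≥ (0 : ℝ),
    Tendsto (fun t => ∫ x in (-R)..R, |U x t - U x t₀|) (𝓝[≥] t₀) (𝓝 0)

/-- `x` is a Filippov solution on the set `s` of the differential inclusion
`ẋ(t) ∈ [f(U(x(t)+, t), C), f(U(x(t)-, t), C)]`, where `f` is the normalized relative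
entropy flux: `x` is Lipschitz on `s` and for a.e. `t ∈ s` it has a derivative lying
in the prescribed interval. -/
def IsFilippov (A η : ℝ → ℝ) (Um Up : ℝ → ℝ → ℝ) (C : ℝ) (s : Set ℝ) (x : ℝ → ℝ) : Prop :=
  (∃ K : NNReal, LipschitzOnWith K x s) ∧
  ∀ᵐ t ∂(volume.restrict s), ∃ d, HasDerivAt x d t ∧
    normFlux A η (Up (x t) t) C ≤ d ∧ d ≤ normFlux A η (Um (x t) t) C

theorem deriv_smoothTransition_of_notMem {s : ℝ} (hs : s ∉ Icc (0 : ℝ) 1) :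
    deriv Real.smoothTransition s = 0 := by
  rw [mem_Icc, not_and_or, not_le, not_le] at hs
  rcases hs with hs | hs
  · have : Real.smoothTransition =ᶠ[𝓝 s] fun _ => 0 := by
      filter_upwards [Iio_mem_nhds hs] with y hy
      exact Real.smoothTransition.zero_of_nonpos (le_of_lt hy)
    rw [this.deriv_eq, deriv_const]
  · have : Real.smoothTransition =ᶠ[𝓝 s] fun _ => 1 := by
      filter_upwards [Ioi_mem_nhds hs] with y hy
      exact Real.smoothTransition.one_of_one_le (le_of_lt hy)
    rw [this.deriv_eq, deriv_const]

theorem continuous_deriv_smoothTransition : Continuous (deriv Real.smoothTransition) :=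
  (Real.smoothTransition.contDiff (n := 1)).continuous_deriv le_rfl

theorem hasDerivAt_smoothTransition (s : ℝ) :
    HasDerivAt Real.smoothTransition (deriv Real.smoothTransition s) s :=
  ((Real.smoothTransition.contDiff (n := 1)).differentiable one_ne_zero s).hasDerivAt

theorem hasCompactSupport_deriv_smoothTransition :
    HasCompactSupport (deriv Real.smoothTransition) :=
  HasCompactSupport.intro isCompact_Icc fun _ => deriv_smoothTransition_of_notMem

theorem integrable_deriv_smoothTransition : Integrable (deriv Real.smoothTransition) :=
  continuous_deriv_smoothTransition.integrable_of_hasCompactSupport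
    hasCompactSupport_deriv_smoothTransition

theorem integral_deriv_smoothTransition : ∫ s, deriv Real.smoothTransition s = 1 := by
  have h := integral_of_hasDerivAt_of_tendsto (m := 0) (n := 1) hasDerivAt_smoothTransition
    integrable_deriv_smoothTransition
    (tendsto_const_nhds.congr' (by
      filter_upwards [Iic_mem_atBot (0 : ℝ)] with y hy
      exact (Real.smoothTransition.zero_of_nonpos hy).symm))
    (tendsto_const_nhds.congr' (by
      filter_upwards [Ici_mem_atTop (1 : ℝ)] with y hy
      exact (Real.smoothTransition.one_of_one_le hy).symm))
  simpa using h

theorem deriv_smoothTransition_nonneg (s : ℝ) : 0 ≤ deriv Real.smoothTransition s :=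
  Real.smoothTransition.monotone.deriv_nonneg

/-- The rescaled kernel `ε⁻¹ S'((x - p) / ε)`, where `S` is the smooth transition function. It is
supported in `[p, p + ε]` and has integral one. -/
def layer (p ε x : ℝ) : ℝ := deriv Real.smoothTransition ((x - p) / ε) / ε

theorem continuous_layer (p ε : ℝ) : Continuous (layer p ε) :=
  (continuous_deriv_smoothTransition.comp (by fun_prop)).div_const ε

theorem layer_eq_zero {p ε x : ℝ} (hε : 0 < ε) (hx : x ∉ Icc p (p + ε)) : layer p ε x = 0 := by
  rw [layer, deriv_smoothTransition_of_notMem, zero_div]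
  contrapose! hx
  rw [mem_Icc, le_div_iff₀ hε, div_le_iff₀ hε] at hx
  constructor <;> linarith [hx.1, hx.2]

theorem integral_layer_mul {p ε : ℝ} (hε : 0 < ε) (W : ℝ → ℝ) :
    ∫ x, layer p ε x * W x = ∫ s, deriv Real.smoothTransition s * W (p + ε * s) := by
  have h1 := Measure.integral_comp_mul_left (fun y => layer p ε (p + y) * W (p + y)) ε
  have h2 := integral_add_left_eq_self (μ := volume) (fun y => layer p ε y * W y) p
  rw [h2, abs_of_pos (inv_pos.2 hε), smul_eq_mul] at h1
  rw [← mul_right_inj' (inv_pos.2 hε).ne', ← h1, ← integral_const_mul]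
  refine integral_congr_ae (Eventually.of_forall fun s => ?_)
  simp only [layer, add_sub_cancel_left, mul_div_cancel_left₀ s hε.ne']
  ring

theorem integrable_layer_mul {p ε : ℝ} (hε : 0 < ε) {W : ℝ → ℝ} (hW : Measurable W) {B : ℝ}
    (hB : ∀ x, |W x| ≤ B) : Integrable fun x => layer p ε x * W x :=
  ((continuous_layer p ε).integrable_of_hasCompactSupport
    (HasCompactSupport.intro isCompact_Icc fun _ => layer_eq_zero hε)).mul_bdd (c := B)
    hW.aestronglyMeasurable (Eventually.of_forall hB)

theorem abs_integral_layer_mul_le {p ε : ℝ} (hε : 0 < ε) {W : ℝ → ℝ} {B : ℝ}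
    (hB : ∀ x, |W x| ≤ B) : |∫ x, layer p ε x * W x| ≤ B := by
  rw [integral_layer_mul hε]
  have h := norm_integral_le_of_norm_le (integrable_deriv_smoothTransition.const_mul B)
    (f := fun s => deriv Real.smoothTransition s * W (p + ε * s))
    (Eventually.of_forall fun s => by
      rw [norm_mul, Real.norm_of_nonneg (deriv_smoothTransition_nonneg s), mul_comm]
      exact mul_le_mul_of_nonneg_right (hB _) (deriv_smoothTransition_nonneg s))
  rwa [integral_const_mul, integral_deriv_smoothTransition, mul_one] at h

theorem tendsto_integral_layer_mul {W : ℝ → ℝ} (hW : Measurable W) {B : ℝ}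
    (hB : ∀ x, |W x| ≤ B) {l : Filter ℝ} {w : ℝ} (hl : Tendsto W l (𝓝 w)) {p ε : ℕ → ℝ}
    (hε : ∀ n, 0 < ε n) (hp : ∀ s ∈ Ioo (0 : ℝ) 1, Tendsto (fun n => p n + ε n * s) atTop l) :
    Tendsto (fun n => ∫ x, layer (p n) (ε n) x * W x) atTop (𝓝 w) := by
  simp only [integral_layer_mul (hε _)]
  have hw : w = ∫ s, deriv Real.smoothTransition s * w := by
    rw [integral_mul_const, integral_deriv_smoothTransition, one_mul]
  rw [hw]
  refine tendsto_integral_of_dominated_convergence (fun s => deriv Real.smoothTransition s * B)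
    (fun n => ?_) (integrable_deriv_smoothTransition.mul_const B) (fun n => ?_) ?_
  · exact (continuous_deriv_smoothTransition.measurable.mul
      (hW.comp (by fun_prop))).aestronglyMeasurable
  · refine Eventually.of_forall fun s => ?_
    rw [norm_mul, Real.norm_of_nonneg (deriv_smoothTransition_nonneg s)]
    exact mul_le_mul_of_nonneg_left (hB _) (deriv_smoothTransition_nonneg s)
  · have h01 : ∀ᵐ s : ℝ, s ∉ ({0, 1} : Set ℝ) :=
      measure_eq_zero_iff_ae_notMem.1 ((Set.toFinite _).measure_zero _)
    filter_upwards [h01] with s hs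
    by_cases h : s ∈ Icc (0 : ℝ) 1
    · refine (hl.comp (hp s ?_)).const_mul _
      simp only [mem_insert_iff, mem_singleton_iff, not_or] at hs
      exact ⟨lt_of_le_of_ne h.1 (Ne.symm hs.1), lt_of_le_of_ne h.2 hs.2⟩
    · simp [deriv_smoothTransition_of_notMem h]

theorem exists_smooth_approx {x : ℝ → ℝ} {K : NNReal} (hx : LipschitzWith K x) {ε : ℝ}
    (hε : 0 < ε) : ∃ p : ℝ → ℝ, ContDiff ℝ (⊤ : ℕ∞) p ∧ (∀ t, |p t - x t| ≤ ε) ∧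
      (∀ t, |deriv p t| ≤ K) ∧ ∀ t, deriv p t =
        ∫ s, deriv (deriv Real.smoothTransition) s *
          ((x (t - ε / (K + 1) * s) - x t) / (ε / (K + 1))) := by
  have hK : (0 : ℝ) < K + 1 := by positivity
  set r := ε / ((K : ℝ) + 1) with hr
  have hr0 : 0 < r := by positivity
  set k := deriv Real.smoothTransition with hk
  have hksm : ContDiff ℝ (⊤ : ℕ∞) k :=
    (contDiff_infty_iff_deriv.1 Real.smoothTransition.contDiff).2
  have hkc : HasCompactSupport k := hasCompactSupport_deriv_smoothTransition
  have hyc : Continuous fun τ => x (r * τ) := hx.continuous.comp (by fun_prop)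
  let Z := MeasureTheory.convolution k (fun τ => x (r * τ)) (ContinuousLinearMap.mul ℝ ℝ) volume
  have hZ : ContDiff ℝ (⊤ : ℕ∞) Z :=
    hkc.contDiff_convolution_left _ hksm hyc.locallyIntegrable
  have hZe : ∀ t, Z (t / r) = ∫ s, k s * x (t - r * s) := by
    intro t
    simp only [Z, convolution, ContinuousLinearMap.mul_apply']
    refine integral_congr_ae (Eventually.of_forall fun s => ?_)
    simp only [mul_sub, mul_div_cancel₀ t hr0.ne']
  have hint : ∀ (g : ℝ → ℝ), Continuous g → HasCompactSupport g → ∀ t,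
      Integrable fun s => g s * x (t - r * s) := fun g hg hgc t =>
    (hg.mul (hx.continuous.comp (by fun_prop))).integrable_of_hasCompactSupport hgc.mul_right
  have hdk : Continuous (deriv k) := hksm.continuous_deriv (by simp)
  have hbound : ∀ (f : ℝ → ℝ) (c : ℝ), (∀ s ∈ Icc (0 : ℝ) 1, |f s| ≤ c) →
      |∫ s, k s * f s| ≤ c := by
    intro f c hf
    have h := norm_integral_le_of_norm_le (integrable_deriv_smoothTransition.mul_const c)
      (f := fun s => k s * f s)
      (Eventually.of_forall fun s => by
        rw [norm_mul, Real.norm_of_nonneg (deriv_smoothTransition_nonneg s)]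
        by_cases hs : s ∈ Icc (0 : ℝ) 1
        · exact mul_le_mul_of_nonneg_left (hf s hs) (deriv_smoothTransition_nonneg s)
        · simp [deriv_smoothTransition_of_notMem hs])
    rwa [integral_mul_const, integral_deriv_smoothTransition, one_mul] at h
  have hlip : ∀ a b, |x a - x b| ≤ K * |a - b| := fun a b => hx.dist_le_mul a b
  have hdZ : ∀ t, HasDerivAt (fun t => Z (t / r))
      (∫ s, deriv k s * ((x (t - r * s) - x t) / r)) t := by
    intro t
    have h1 := (hkc.hasDerivAt_convolution_left (ContinuousLinearMap.mul ℝ ℝ) (μ := volume)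
      (hksm.of_le (by simp)) hyc.locallyIntegrable (t / r))
    have h2 := h1.comp t ((hasDerivAt_id t).div_const r)
    refine h2.congr_deriv ?_
    simp only [convolution, ContinuousLinearMap.mul_apply', mul_sub, mul_div_cancel₀ t hr0.ne']
    have hk0 : ∫ s, deriv k s = 0 := by
      have hz : ∀ s ∉ Icc (0 : ℝ) 1, k s = 0 := fun s => deriv_smoothTransition_of_notMem
      have h := integral_of_hasDerivAt_of_tendsto (m := 0) (n := 0)
        (fun s => (hksm.differentiable (by simp) s).hasDerivAt)
        (hdk.integrable_of_hasCompactSupport hkc.deriv)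
        (tendsto_const_nhds.congr' (by
          filter_upwards [Iio_mem_atBot (0 : ℝ)] with y hy
          exact (hz y fun h => absurd h.1 (not_le.2 hy)).symm))
        (tendsto_const_nhds.congr' (by
          filter_upwards [Ioi_mem_atTop (1 : ℝ)] with y hy
          exact (hz y fun h => absurd h.2 (not_le.2 hy)).symm))
      simpa using h
    calc (∫ s, deriv k s * x (t - r * s)) * (1 / r)
        = (∫ s, deriv k s * x (t - r * s)) * (1 / r) - (∫ s, deriv k s) * (x t / r) := by
          rw [hk0, zero_mul, sub_zero]
      _ = ∫ s, (deriv k s * x (t - r * s) * (1 / r) - deriv k s * (x t / r)) := by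
          rw [integral_sub ((hint _ hdk hkc.deriv t).mul_const _)
            ((hdk.integrable_of_hasCompactSupport hkc.deriv).mul_const _),
            integral_mul_const, integral_mul_const]
      _ = _ := integral_congr_ae (Eventually.of_forall fun s => by ring)
  refine ⟨fun t => Z (t / r), hZ.comp (by fun_prop), fun t => ?_, fun t => ?_,
    fun t => (hdZ t).deriv⟩
  · have h : Z (t / r) - x t = ∫ s, k s * (x (t - r * s) - x t) := by
      simp only [mul_sub]
      rw [integral_sub (hint _ hksm.continuous hkc t)
        (integrable_deriv_smoothTransition.mul_const _), integral_mul_const,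
        integral_deriv_smoothTransition, hZe, one_mul]
    rw [h]
    refine hbound _ _ fun s hs => (hlip _ _).trans ?_
    rw [sub_sub_cancel_left, abs_neg, abs_mul, abs_of_pos hr0, abs_of_nonneg hs.1]
    have h1 : r * s ≤ r := mul_le_of_le_one_right hr0.le hs.2
    have h2 : ((K : ℝ) + 1) * r = ε := by rw [hr]; field_simp
    nlinarith [K.coe_nonneg]
  · refine norm_deriv_le_of_lipschitz (f := fun t => Z (t / r))
      (LipschitzWith.of_dist_le_mul fun a b => ?_)
    rw [Real.dist_eq, Real.dist_eq, hZe, hZe, ← integral_sub (hint _ hksm.continuous hkc a)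
      (hint _ hksm.continuous hkc b)]
    simp only [← mul_sub]
    refine hbound _ _ fun s _ => (hlip _ _).trans ?_
    rw [sub_sub_sub_cancel_right]

theorem tendsto_integral_deriv_mul_slope {x : ℝ → ℝ} {K : NNReal} (hx : LipschitzWith K x)
    {t d : ℝ} (hd : HasDerivAt x d t) {r : ℕ → ℝ} (hr0 : ∀ n, 0 < r n)
    (hr : Tendsto r atTop (𝓝 0)) :
    Tendsto (fun n => ∫ s, deriv (deriv Real.smoothTransition) s *
      ((x (t - r n * s) - x t) / r n)) atTop (𝓝 d) := by
  set k := deriv Real.smoothTransition with hk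
  have hksm : ContDiff ℝ (⊤ : ℕ∞) k :=
    (contDiff_infty_iff_deriv.1 Real.smoothTransition.contDiff).2
  have hkc : HasCompactSupport k := hasCompactSupport_deriv_smoothTransition
  have hdk : Continuous (deriv k) := hksm.continuous_deriv (by simp)
  have hd' : d = ∫ s, deriv k s * (-s * d) := by
    have h := integral_mul_deriv_eq_deriv_mul_of_integrable (u := fun s : ℝ => s) (u' := fun _ => 1)
      (v := k) (v' := deriv k) (fun s _ => hasDerivAt_id s)
      (fun s _ => (hksm.differentiable (by simp) s).hasDerivAt)
      ((continuous_id.mul hdk).integrable_of_hasCompactSupport hkc.deriv.mul_left)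
      ((continuous_const.mul hksm.continuous).integrable_of_hasCompactSupport hkc.mul_left)
      ((continuous_id.mul hksm.continuous).integrable_of_hasCompactSupport hkc.mul_left)
    simp only [one_mul] at h
    rw [integral_deriv_smoothTransition] at h
    calc d = -(∫ s, s * deriv k s) * d := by rw [h]; ring
      _ = ∫ s, -(s * deriv k s) * d := by rw [integral_mul_const, integral_neg]
      _ = _ := integral_congr_ae (Eventually.of_forall fun s => by ring)
  conv => rhs; rw [hd']
  refine tendsto_integral_of_dominated_convergence (fun s => |deriv k s| * (K * |s|))
    (fun n => ?_) ?_ (fun n => ?_) ?_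
  · exact (hdk.mul (((hx.continuous.comp (by fun_prop)).sub continuous_const).div_const
      _)).aestronglyMeasurable
  · exact (hdk.abs.mul (by fun_prop)).integrable_of_hasCompactSupport hkc.deriv.norm.mul_right
  · refine Eventually.of_forall fun s => ?_
    rw [Real.norm_eq_abs, abs_mul, abs_div, abs_of_pos (hr0 n)]
    gcongr
    rw [div_le_iff₀ (hr0 n)]
    have h := hx.dist_le_mul (t - r n * s) t
    rw [Real.dist_eq, Real.dist_eq, sub_sub_cancel_left, abs_neg, abs_mul, abs_of_pos (hr0 n)] at h
    linarith
  · refine Eventually.of_forall fun s => Tendsto.const_mul _ ?_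
    have h1 : HasDerivAt (fun ρ => x (t - ρ * s)) (-s * d) 0 := by
      have h2 : HasDerivAt (fun ρ : ℝ => t - ρ * s) (-s) 0 := by
        simpa using ((hasDerivAt_id (0 : ℝ)).mul_const s).const_sub t
      have h3 : HasDerivAt x d (t - 0 * s) := by simpa using hd
      exact (h3.comp 0 h2).congr_deriv (mul_comm _ _)
    have h4 := hasDerivAt_iff_tendsto_slope.1 h1
    have h5 : Tendsto r atTop (𝓝[≠] 0) :=
      tendsto_nhdsWithin_iff.2 ⟨hr, Eventually.of_forall fun n => (hr0 n).ne'⟩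
    refine (h4.comp h5).congr fun n => ?_
    simp [slope_def_field]

theorem exists_smooth_seq {x : ℝ → ℝ} {K : NNReal} (hx : LipschitzWith K x) {ε : ℕ → ℝ}
    (hε0 : ∀ n, 0 < ε n) (hε : Tendsto ε atTop (𝓝 0)) :
    ∃ p : ℕ → ℝ → ℝ, (∀ n, ContDiff ℝ (⊤ : ℕ∞) (p n)) ∧ (∀ n t, |p n t - x t| ≤ ε n) ∧
      (∀ n t, |deriv (p n) t| ≤ K) ∧
      ∀ t d, HasDerivAt x d t → Tendsto (fun n => deriv (p n) t) atTop (𝓝 d) := by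
  choose p hp1 hp2 hp3 hp4 using fun n => exists_smooth_approx hx (hε0 n)
  refine ⟨p, hp1, hp2, hp3, fun t d hd => ?_⟩
  simp only [hp4]
  exact tendsto_integral_deriv_mul_slope hx hd (r := fun n => ε n / (K + 1))
    (fun n => div_pos (hε0 n) (by positivity)) (by simpa using hε.div_const ((K : ℝ) + 1))

/-- The smoothed indicator function of the interval `(p, q)` with transition layers of width `ε`. -/
def cutoff (p q ε x : ℝ) : ℝ :=
  Real.smoothTransition ((x - p) / ε) - Real.smoothTransition ((x - q) / ε)

theorem cutoff_nonneg {p q ε : ℝ} (hε : 0 < ε) (hpq : p ≤ q) (x : ℝ) : 0 ≤ cutoff p q ε x :=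
  sub_nonneg.2 (Real.smoothTransition.monotone (by gcongr))

theorem abs_cutoff_le_one (p q ε x : ℝ) : |cutoff p q ε x| ≤ 1 := by
  have h1 := Real.smoothTransition.le_one ((x - p) / ε)
  have h2 := Real.smoothTransition.nonneg ((x - q) / ε)
  have h3 := Real.smoothTransition.le_one ((x - q) / ε)
  have h4 := Real.smoothTransition.nonneg ((x - p) / ε)
  unfold cutoff; rw [abs_le]; constructor <;> linarith

theorem cutoff_eq_zero {p q ε x a b : ℝ} (hε : 0 < ε) (hap : a ≤ p) (haq : a ≤ q)
    (hpb : p + ε ≤ b) (hqb : q + ε ≤ b) (hx : x ∉ Ioo a b) : cutoff p q ε x = 0 := by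
  rw [mem_Ioo, not_and_or, not_lt, not_lt] at hx
  unfold cutoff
  rcases hx with hx | hx
  · rw [Real.smoothTransition.zero_of_nonpos (div_nonpos_of_nonpos_of_nonneg (by linarith) hε.le),
      Real.smoothTransition.zero_of_nonpos (div_nonpos_of_nonpos_of_nonneg (by linarith) hε.le),
      sub_zero]
  · rw [Real.smoothTransition.one_of_one_le ((one_le_div hε).2 (by linarith)),
      Real.smoothTransition.one_of_one_le ((one_le_div hε).2 (by linarith)), sub_self]

theorem cutoff_eq_one {p q ε x : ℝ} (hε : 0 < ε) (hp : p + ε ≤ x) (hq : x ≤ q) :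
    cutoff p q ε x = 1 := by
  unfold cutoff
  rw [Real.smoothTransition.one_of_one_le ((one_le_div hε).2 (by linarith)),
      Real.smoothTransition.zero_of_nonpos (div_nonpos_of_nonpos_of_nonneg (by linarith) hε.le),
      sub_zero]

theorem hasDerivAt_cutoff (p q ε x : ℝ) :
    HasDerivAt (fun y => cutoff p q ε y) (layer p ε x - layer q ε x) x := by
  have h : ∀ c, HasDerivAt (fun y => Real.smoothTransition ((y - c) / ε)) (layer c ε x) x := by
    intro c
    refine ((hasDerivAt_smoothTransition ((x - c) / ε)).comp x
      (((hasDerivAt_id x).sub_const c).div_const ε)).congr_deriv ?_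
    simp only [layer]; ring
  exact (h p).sub (h q)

theorem hasDerivAt_cutoff_comp {p q : ℝ → ℝ} {p' q' t : ℝ} (hp : HasDerivAt p p' t)
    (hq : HasDerivAt q q' t) (ε x : ℝ) :
    HasDerivAt (fun s => cutoff (p s) (q s) ε x)
      (q' * layer (q t) ε x - p' * layer (p t) ε x) t := by
  have h : ∀ {c : ℝ → ℝ} {c' : ℝ}, HasDerivAt c c' t →
      HasDerivAt (fun s => Real.smoothTransition ((x - c s) / ε)) (-(c' * layer (c t) ε x)) t := by
    intro c c' hc
    refine ((hasDerivAt_smoothTransition ((x - c t) / ε)).comp t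
      ((hc.const_sub x).div_const ε)).congr_deriv ?_
    simp only [layer]; ring
  exact ((h hp).sub (h hq)).congr_deriv (by ring)

theorem tendsto_integral_cutoff_mul {W : ℝ → ℝ} (hW : Measurable W) {B : ℝ} (hB : ∀ x, |W x| ≤ B)
    {xL xR δ : ℝ} (hδ : 0 < δ) (hLR : δ ≤ xR - xL) {p q ε : ℕ → ℝ} (hε0 : ∀ n, 0 < ε n)
    (hε : Tendsto ε atTop (𝓝 0)) (hp1 : ∀ n, xL + ε n ≤ p n) (hp2 : ∀ n, p n ≤ xL + 3 * ε n)
    (hq1 : ∀ n, xR - 4 * ε n ≤ q n) (hq2 : ∀ n, q n ≤ xR - 2 * ε n) :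
    Tendsto (fun n => ∫ x, W x * cutoff (p n) (q n) (ε n) x) atTop (𝓝 (∫ x in xL..xR, W x)) := by
  have hle : xL ≤ xR := by linarith
  rw [intervalIntegral.integral_of_le hle, integral_Ioc_eq_integral_Ioo,
    ← integral_indicator measurableSet_Ioo]
  have hsm : ∀ᶠ n in atTop, 8 * ε n < δ := by
    have : Tendsto (fun n => 8 * ε n) atTop (𝓝 0) := by simpa using hε.const_mul 8
    exact this.eventually_lt_const hδ
  refine tendsto_integral_filter_of_dominated_convergence ((Icc xL xR).indicator fun _ => B)
    (Eventually.of_forall fun n => ?_) ?_ ?_ (Eventually.of_forall fun x => ?_)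
  · have hc : Continuous fun x => cutoff (p n) (q n) (ε n) x :=
      continuous_iff_continuousAt.2 fun x => (hasDerivAt_cutoff _ _ _ x).continuousAt
    exact (hW.mul hc.measurable).aestronglyMeasurable
  · filter_upwards [hsm] with n hn
    refine Eventually.of_forall fun x => ?_
    by_cases hx : x ∈ Icc xL xR
    · rw [indicator_of_mem hx, norm_mul]
      exact (mul_le_of_le_one_right (norm_nonneg _) (abs_cutoff_le_one _ _ _ _)).trans (hB x)
    · rw [indicator_of_notMem hx, cutoff_eq_zero (hε0 n) _ _ _ _
        fun h => hx (Ioo_subset_Icc_self h), mul_zero, norm_zero] <;>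
        linarith [hp1 n, hp2 n, hq1 n, hq2 n, hε0 n]
  · exact (integrable_indicator_iff measurableSet_Icc).2 (integrableOn_const (by simp))
  · have hconst : ∀ c : ℝ, Tendsto (fun n => c * ε n) atTop (𝓝 0) := fun c => by
      simpa using hε.const_mul c
    by_cases hx : x ∈ Ioo xL xR
    · rw [indicator_of_mem hx]
      refine tendsto_const_nhds.congr' ?_
      filter_upwards [(hconst 8).eventually_lt_const (sub_pos.2 hx.1),
        (hconst 8).eventually_lt_const (sub_pos.2 hx.2)] with n h1 h2
      rw [cutoff_eq_one (hε0 n), mul_one] <;> linarith [hp2 n, hq1 n, hε0 n]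
    · rw [indicator_of_notMem hx]
      refine tendsto_const_nhds.congr' ?_
      filter_upwards [hsm] with n hn
      rw [cutoff_eq_zero (a := xL + ε n) (b := xR - ε n) (hε0 n), mul_zero]
      any_goals linarith [hp1 n, hp2 n, hq1 n, hq2 n, hε0 n]
      exact fun h => hx ⟨by linarith [h.1, hε0 n], by linarith [h.2, hε0 n]⟩

theorem abs_integral_mul_cutoff_le {W : ℝ → ℝ} {B : ℝ} (hB : ∀ x, |W x| ≤ B) {p q ε a b : ℝ}
    (hε : 0 < ε) (hap : a ≤ p) (haq : a ≤ q) (hpb : p + ε ≤ b) (hqb : q + ε ≤ b) :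
    |∫ x, W x * cutoff p q ε x| ≤ B * (b - a) := by
  have hint : Integrable ((Icc a b).indicator fun _ => B) :=
    (integrable_indicator_iff measurableSet_Icc).2 (integrableOn_const (by simp))
  have h := norm_integral_le_of_norm_le hint (f := fun x => W x * cutoff p q ε x)
    (Eventually.of_forall fun x => by
      by_cases hx : x ∈ Icc a b
      · rw [indicator_of_mem hx, norm_mul]
        exact (mul_le_of_le_one_right (norm_nonneg _) (abs_cutoff_le_one _ _ _ _)).trans (hB x)
      · rw [indicator_of_notMem hx, cutoff_eq_zero hε hap haq hpb hqb
          fun h => hx (Ioo_subset_Icc_self h), mul_zero, norm_zero])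
  rw [integral_indicator measurableSet_Icc, setIntegral_const, smul_eq_mul, Real.volume_real_Icc,
    max_eq_left (by linarith)] at h
  rw [mul_comm]; exact h

theorem integrable_mul_cutoff {W : ℝ → ℝ} (hW : Measurable W) {B : ℝ} (hB : ∀ x, |W x| ≤ B)
    {p q ε : ℝ} (hε : 0 < ε) : Integrable fun x => W x * cutoff p q ε x := by
  have hc : Continuous fun x => cutoff p q ε x :=
    continuous_iff_continuousAt.2 fun x => (hasDerivAt_cutoff _ _ _ x).continuousAt
  refine (hc.integrable_of_hasCompactSupport (HasCompactSupport.intro isCompact_Icc fun x hx =>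
    cutoff_eq_zero hε (min_le_left p q) (min_le_right p q) (add_le_add_left (le_max_left p q) ε)
      (add_le_add_left (le_max_right p q) ε) fun h => hx (Ioo_subset_Icc_self h))).bdd_mul
    (c := B) hW.aestronglyMeasurable (Eventually.of_forall hB)

theorem exists_bound_comp {e : ℝ → ℝ} (he : Continuous e) {U : ℝ → ℝ → ℝ} {M : ℝ}
    (hM : ∀ x t, |U x t| ≤ M) : ∃ B, 0 ≤ B ∧ ∀ x t, |e (U x t)| ≤ B := by
  obtain ⟨B, hB⟩ := (isCompact_Icc (a := -M) (b := M)).exists_bound_of_continuousOn he.continuousOn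
  exact ⟨max B 0, le_max_right _ _, fun x t => (hB _ (abs_le.1 (hM x t))).trans (le_max_left _ _)⟩

theorem contDiff_cutoff {p q ψ : ℝ → ℝ} (hp : ContDiff ℝ (⊤ : ℕ∞) p) (hq : ContDiff ℝ (⊤ : ℕ∞) q)
    (hψ : ContDiff ℝ (⊤ : ℕ∞) ψ) (ε : ℝ) :
    ContDiff ℝ (⊤ : ℕ∞) fun z : ℝ × ℝ => ψ z.2 * cutoff (p z.2) (q z.2) ε z.1 := by
  have h : ∀ {c : ℝ → ℝ}, ContDiff ℝ (⊤ : ℕ∞) c →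
      ContDiff ℝ (⊤ : ℕ∞) fun z : ℝ × ℝ => Real.smoothTransition ((z.1 - c z.2) / ε) := fun hc =>
    Real.smoothTransition.contDiff.comp ((contDiff_fst.sub (hc.comp contDiff_snd)).div_const ε)
  exact (hψ.comp contDiff_snd).mul ((h hp).sub (h hq))

theorem hasCompactSupport_cutoff {p q ψ : ℝ → ℝ} (hp : Continuous p) (hq : Continuous q)
    {t₀ T ε : ℝ} (hε : 0 < ε) (hψ : ∀ t ∉ Icc t₀ T, ψ t = 0) :
    HasCompactSupport fun z : ℝ × ℝ => ψ z.2 * cutoff (p z.2) (q z.2) ε z.1 := by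
  obtain ⟨P, hP⟩ := (isCompact_Icc (a := t₀) (b := T)).exists_bound_of_continuousOn hp.continuousOn
  obtain ⟨Q, hQ⟩ := (isCompact_Icc (a := t₀) (b := T)).exists_bound_of_continuousOn hq.continuousOn
  refine HasCompactSupport.intro
    ((isCompact_Icc (a := -max P Q) (b := max P Q + ε)).prod (isCompact_Icc (a := t₀) (b := T))) ?_
  rintro ⟨x, t⟩ hxt
  by_cases ht : t ∈ Icc t₀ T
  · have hx : x ∉ Icc (-max P Q) (max P Q + ε) := fun hx => hxt ⟨hx, ht⟩
    have h1 := abs_le.1 (hP t ht)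
    have h2 := abs_le.1 (hQ t ht)
    have h3 := le_max_left P Q
    have h4 := le_max_right P Q
    simp only
    rw [cutoff_eq_zero hε _ _ _ _ fun h => hx (Ioo_subset_Icc_self h), mul_zero] <;> linarith
  · simp [hψ t ht]

theorem measurable_integral_between {g : ℝ → ℝ → ℝ} (hg : Measurable fun z : ℝ × ℝ => g z.1 z.2)
    {xL xR : ℝ → ℝ} (hxL : Measurable xL) (hxR : Measurable xR) (hle : ∀ t, xL t ≤ xR t) :
    Measurable fun t => ∫ x in xL t..xR t, g x t := by
  have hS : MeasurableSet {z : ℝ × ℝ | xL z.1 < z.2 ∧ z.2 ≤ xR z.1} :=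
    (measurableSet_lt (hxL.comp measurable_fst) measurable_snd).inter
      (measurableSet_le measurable_snd (hxR.comp measurable_fst))
  have h := ((hg.comp measurable_swap).indicator hS).stronglyMeasurable.integral_prod_right'
    (ν := volume)
  convert h.measurable using 2 with t
  rw [intervalIntegral.integral_of_le (hle t), ← integral_indicator measurableSet_Ioc]
  rfl

theorem abs_integral_between_le {W : ℝ → ℝ} {C B a b : ℝ} (hW : ∀ x, |W x| ≤ C) (hC : 0 ≤ C)
    (hab : a ≤ b) (hB : b - a ≤ B) : |∫ x in a..b, W x| ≤ C * B := by
  refine (intervalIntegral.norm_integral_le_of_norm_le_const (f := W) (C := C)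
    fun x _ => hW x).trans ?_
  rw [abs_of_nonneg (sub_nonneg.2 hab)]
  gcongr

theorem integral_deriv_mul_entropy_nonneg {A : ℝ → ℝ} {U Um Up : ℝ → ℝ → ℝ}
    (hsol : IsEntropySol A U) (hlim : HasSideLimits U Um Up) {e G : ℝ → ℝ}
    (he : ContDiff ℝ (⊤ : ℕ∞) e) (hG : ContDiff ℝ (⊤ : ℕ∞) G) (he2 : ∀ v, 0 ≤ deriv (deriv e) v)
    (hGe : ∀ v, deriv G v = deriv e v * deriv A v) {xL xR : ℝ → ℝ} {K : NNReal}
    (hxL : LipschitzWith K xL) (hxR : LipschitzWith K xR) {δ B : ℝ} (hδ : 0 < δ)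
    (hD : ∀ t, δ ≤ xR t - xL t) (hB : ∀ t, xR t - xL t ≤ B) {t₀ T : ℝ} (ht₀ : 0 ≤ t₀)
    (hbd : ∀ᵐ t ∂volume.restrict (Icc t₀ T), ∃ dL dR, HasDerivAt xL dL t ∧ HasDerivAt xR dR t ∧
      G (Up (xL t) t) ≤ dL * e (Up (xL t) t) ∧ dR * e (Um (xR t) t) ≤ G (Um (xR t) t))
    {ψ : ℝ → ℝ} (hψ : ContDiff ℝ (⊤ : ℕ∞) ψ) (hψ0 : ∀ t, 0 ≤ ψ t) (hψs' : ∀ t ∉ Ioo t₀ T, ψ t = 0) :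
    0 ≤ ∫ t in Ioi (0 : ℝ), deriv ψ t * ∫ x in xL t..xR t, e (U x t) := by
  obtain ⟨M, hM⟩ := hsol.bounded
  obtain ⟨Be, hBe0, hBe⟩ := exists_bound_comp he.continuous hM
  obtain ⟨Bg, hBg0, hBg⟩ := exists_bound_comp hG.continuous hM
  have hUm := hsol.measurable
  have hUt : ∀ t, Measurable fun x => U x t := fun t =>
    hUm.comp (measurable_id.prodMk measurable_const)
  have heU : ∀ t, Measurable fun x => e (U x t) := fun t => he.continuous.measurable.comp (hUt t)
  have hGU : ∀ t, Measurable fun x => G (U x t) := fun t => hG.continuous.measurable.comp (hUt t)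
  set ε : ℕ → ℝ := fun n => δ / 8 * (1 / ((n : ℝ) + 1)) with hεdef
  have hε0 : ∀ n, 0 < ε n := fun n => by positivity
  have hε8 : ∀ n, 8 * ε n ≤ δ := fun n => by
    have : 1 / ((n : ℝ) + 1) ≤ 1 := by
      rw [div_le_one (by positivity)]; linarith [n.cast_nonneg (α := ℝ)]
    simp only [hεdef]; nlinarith
  have hε : Tendsto ε atTop (𝓝 0) := by
    simpa [hεdef] using tendsto_one_div_add_atTop_nhds_zero_nat.const_mul (δ / 8)
  obtain ⟨P, hP1, hP2, hP3, hP4⟩ := exists_smooth_seq hxL hε0 hε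
  obtain ⟨Q, hQ1, hQ2, hQ3, hQ4⟩ := exists_smooth_seq hxR hε0 hε
  set p : ℕ → ℝ → ℝ := fun n t => P n t + 2 * ε n with hp
  set q : ℕ → ℝ → ℝ := fun n t => Q n t - 3 * ε n with hq
  have hpsm : ∀ n, ContDiff ℝ (⊤ : ℕ∞) (p n) := fun n => (hP1 n).add contDiff_const
  have hqsm : ∀ n, ContDiff ℝ (⊤ : ℕ∞) (q n) := fun n => (hQ1 n).sub contDiff_const
  have hpd : ∀ n t, HasDerivAt (p n) (deriv (P n) t) t := fun n t =>
    ((hP1 n).differentiable (by simp) t).hasDerivAt.add_const _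
  have hqd : ∀ n t, HasDerivAt (q n) (deriv (Q n) t) t := fun n t =>
    ((hQ1 n).differentiable (by simp) t).hasDerivAt.sub_const _
  have hp1 : ∀ n t, xL t + ε n ≤ p n t := fun n t => by
    have := abs_le.1 (hP2 n t); simp only [hp]; linarith
  have hp2 : ∀ n t, p n t ≤ xL t + 3 * ε n := fun n t => by
    have := abs_le.1 (hP2 n t); simp only [hp]; linarith
  have hq1 : ∀ n t, xR t - 4 * ε n ≤ q n t := fun n t => by
    have := abs_le.1 (hQ2 n t); simp only [hq]; linarith
  have hq2 : ∀ n t, q n t ≤ xR t - 2 * ε n := fun n t => by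
    have := abs_le.1 (hQ2 n t); simp only [hq]; linarith
  have hpq : ∀ n t, p n t ≤ q n t := fun n t => by
    linarith [hp2 n t, hq1 n t, hε8 n, hD t, hε0 n]
  have hψs : ∀ t ∉ Icc t₀ T, ψ t = 0 := fun t ht => hψs' t fun h => ht (Ioo_subset_Icc_self h)
  have hψsT : ∀ t ∉ Icc t₀ T, deriv ψ t = 0 := fun t ht => by
    have : ψ =ᶠ[𝓝 t] fun _ => 0 := by
      filter_upwards [isClosed_Icc.isOpen_compl.mem_nhds ht] with y hy
      exact hψs y hy
    rw [this.deriv_eq, deriv_const]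
  have hψd : ∀ t, HasDerivAt ψ (deriv ψ t) t := fun t =>
    (hψ.differentiable (by simp) t).hasDerivAt
  have hψc : HasCompactSupport ψ := HasCompactSupport.intro isCompact_Icc fun t => hψs t
  have hdψ : Continuous (deriv ψ) := hψ.continuous_deriv (by simp)
  let L : ℝ → ℝ → ℝ → (ℝ → ℝ) → ℝ := fun c r t g => ∫ x, layer c r x * g (U x t)
  let I : ℕ → ℝ → ℝ := fun n t =>
    deriv ψ t * (∫ x, e (U x t) * cutoff (p n t) (q n t) (ε n) x) +
      ψ t * ((L (p n t) (ε n) t G - deriv (P n) t * L (p n t) (ε n) t e) +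
        (deriv (Q n) t * L (q n t) (ε n) t e - L (q n t) (ε n) t G))
  have hI : ∀ n, 0 ≤ ∫ t in Ioi (0 : ℝ), I n t := by
    intro n
    have h := hsol.entropy e G he hG he2 hGe
      (fun x t => ψ t * cutoff (p n t) (q n t) (ε n) x)
      (contDiff_cutoff (hpsm n) (hqsm n) hψ (ε n))
      (hasCompactSupport_cutoff (hpsm n).continuous (hqsm n).continuous (hε0 n) hψs)
      (fun x t => mul_nonneg (hψ0 t) (cutoff_nonneg (hε0 n) (hpq n t) x))
      (fun x t ht => by simp [hψs' t fun h => by linarith [h.1]])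
    refine h.trans_eq (integral_congr_ae (Eventually.of_forall fun t => ?_))
    simp only
    have hdt : ∀ x, deriv (fun s => ψ s * cutoff (p n s) (q n s) (ε n) x) t =
        deriv ψ t * cutoff (p n t) (q n t) (ε n) x + ψ t * (deriv (Q n) t * layer (q n t) (ε n) x -
          deriv (P n) t * layer (p n t) (ε n) x) := fun x =>
      ((hψd t).mul (hasDerivAt_cutoff_comp (hpd n t) (hqd n t) (ε n) x)).deriv
    have hdx : ∀ x, deriv (fun y => ψ t * cutoff (p n t) (q n t) (ε n) y) x =
        ψ t * (layer (p n t) (ε n) x - layer (q n t) (ε n) x) := fun x =>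
      ((hasDerivAt_cutoff (p n t) (q n t) (ε n) x).const_mul (ψ t)).deriv
    simp only [hdt, hdx]
    have i1 := integrable_mul_cutoff (heU t) (fun x => hBe x t) (hε0 n) (p := p n t) (q := q n t)
    have i2 := integrable_layer_mul (hε0 n) (heU t) (fun x => hBe x t) (p := p n t)
    have i3 := integrable_layer_mul (hε0 n) (heU t) (fun x => hBe x t) (p := q n t)
    have i4 := integrable_layer_mul (hε0 n) (hGU t) (fun x => hBg x t) (p := p n t)
    have i5 := integrable_layer_mul (hε0 n) (hGU t) (fun x => hBg x t) (p := q n t)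
    have j1 : Integrable fun x => layer (p n t) (ε n) x * G (U x t) -
      deriv (P n) t * (layer (p n t) (ε n) x * e (U x t)) := i4.sub (i2.const_mul _)
    have j2 : Integrable fun x => deriv (Q n) t * (layer (q n t) (ε n) x * e (U x t)) -
      layer (q n t) (ε n) x * G (U x t) := (i3.const_mul _).sub i5
    have j3 : Integrable fun x => layer (p n t) (ε n) x * G (U x t) -
      deriv (P n) t * (layer (p n t) (ε n) x * e (U x t)) +
      (deriv (Q n) t * (layer (q n t) (ε n) x * e (U x t)) -
      layer (q n t) (ε n) x * G (U x t)) := j1.add j2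
    simp only [I, L]
    rw [← integral_const_mul, ← integral_const_mul, ← integral_const_mul,
      ← integral_sub i4 (i2.const_mul _), ← integral_sub (i3.const_mul _) i5,
      ← integral_add j1 j2, ← integral_const_mul,
      ← integral_add (i1.const_mul _) (j3.const_mul _)]
    refine integral_congr_ae (Eventually.of_forall fun x => ?_)
    simp only
    ring
  have hlimL : ∀ t {c : ℕ → ℝ} {l : Filter ℝ} {w : ℝ}, Tendsto (fun y => U y t) l (𝓝 w) →
      (∀ s ∈ Ioo (0 : ℝ) 1, Tendsto (fun n => c n + ε n * s) atTop l) → ∀ {g : ℝ → ℝ},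
      Continuous g → (∃ C, ∀ x, |g (U x t)| ≤ C) →
      Tendsto (fun n => L (c n) (ε n) t g) atTop (𝓝 (g w)) := by
    rintro t c l w hl hc g hg ⟨C, hC⟩
    exact tendsto_integral_layer_mul (hg.measurable.comp (hUt t)) hC
      ((hg.tendsto w).comp hl) hε0 hc
  have hsmall : ∀ c y : ℝ, Tendsto (fun n => y + c * ε n) atTop (𝓝 y) := fun c y => by
    simpa using (hε.const_mul c).const_add y
  have hpl : ∀ t, ∀ s ∈ Ioo (0 : ℝ) 1,
      Tendsto (fun n => p n t + ε n * s) atTop (𝓝[>] (xL t)) := fun t s hs => by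
    refine tendsto_nhdsWithin_iff.2 ⟨tendsto_of_tendsto_of_tendsto_of_le_of_le
      tendsto_const_nhds (hsmall 4 (xL t)) (fun n => ?_) (fun n => ?_),
      Eventually.of_forall fun n => ?_⟩
    all_goals
      have := hp1 n t
      have := hp2 n t
      have := hε0 n
      have := mul_pos (hε0 n) hs.1
      have := mul_lt_of_lt_one_right (hε0 n) hs.2
      simp only [mem_Ioi]
      linarith
  have hql : ∀ t, ∀ s ∈ Ioo (0 : ℝ) 1,
      Tendsto (fun n => q n t + ε n * s) atTop (𝓝[<] (xR t)) := fun t s hs => by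
    refine tendsto_nhdsWithin_iff.2 ⟨tendsto_of_tendsto_of_tendsto_of_le_of_le
      (hsmall (-4) (xR t)) tendsto_const_nhds (fun n => ?_) (fun n => ?_),
      Eventually.of_forall fun n => ?_⟩
    all_goals
      have := hq1 n t
      have := hq2 n t
      have := hε0 n
      have := mul_pos (hε0 n) hs.1
      have := mul_lt_of_lt_one_right (hε0 n) hs.2
      simp only [mem_Iio]
      linarith
  have hlimI : ∀ᵐ t ∂volume.restrict (Ioi (0 : ℝ)), ∃ l, Tendsto (fun n => I n t) atTop (𝓝 l) ∧
      l ≤ deriv ψ t * ∫ x in xL t..xR t, e (U x t) := by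
    rw [ae_restrict_iff' measurableSet_Icc] at hbd
    rw [ae_restrict_iff' measurableSet_Ioi]
    filter_upwards [hbd] with t hbt ht
    by_cases htI : t ∈ Icc t₀ T
    · obtain ⟨dL, dR, h1, h2, h3, h4⟩ := hbt htI
      have c1 := tendsto_integral_cutoff_mul (heU t) (fun x => hBe x t) hδ (hD t) hε0 hε
        (fun n => hp1 n t) (fun n => hp2 n t) (fun n => hq1 n t) (fun n => hq2 n t)
      have c2 := hlimL t (hlim.right (xL t) t ht) (hpl t) he.continuous ⟨Be, fun x => hBe x t⟩
      have c3 := hlimL t (hlim.right (xL t) t ht) (hpl t) hG.continuous ⟨Bg, fun x => hBg x t⟩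
      have c4 := hlimL t (hlim.left (xR t) t ht) (hql t) he.continuous ⟨Be, fun x => hBe x t⟩
      have c5 := hlimL t (hlim.left (xR t) t ht) (hql t) hG.continuous ⟨Bg, fun x => hBg x t⟩
      refine ⟨_, (c1.const_mul _).add (((c3.sub ((hP4 t dL h1).mul c2)).add
        (((hQ4 t dR h2).mul c4).sub c5)).const_mul (ψ t)), ?_⟩
      have := mul_nonpos_of_nonneg_of_nonpos (hψ0 t) (by linarith :
        G (Up (xL t) t) - dL * e (Up (xL t) t) + (dR * e (Um (xR t) t) - G (Um (xR t) t)) ≤ 0)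
      linarith
    · refine ⟨0, tendsto_const_nhds.congr fun n => ?_, ?_⟩ <;> simp [I, hψsT t htI, hψs t htI]
  have : (ae (volume.restrict (Ioi (0 : ℝ)))).NeBot := ae_restrict_neBot.2 (by simp)
  obtain ⟨l, hl⟩ := hlimI.choice
  have hEm : Measurable fun t => ∫ x in xL t..xR t, e (U x t) :=
    measurable_integral_between (g := fun x t => e (U x t)) (he.continuous.measurable.comp hUm)
      hxL.continuous.measurable hxR.continuous.measurable fun t => by linarith [hD t]
  have hlay : ∀ c : ℝ → ℝ, Continuous c → ∀ r g, Continuous g →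
      Measurable fun t => L (c t) r t g := fun c hc r g hg => by
    have hm : Measurable fun z : ℝ × ℝ => layer (c z.1) r z.2 * g (U z.2 z.1) :=
      ((continuous_deriv_smoothTransition.measurable.comp
        ((measurable_snd.sub (hc.measurable.comp measurable_fst)).div_const r)).div_const r).mul
        (hg.measurable.comp (hUm.comp measurable_swap))
    exact (hm.stronglyMeasurable.integral_prod_right' (ν := volume)).measurable
  have hJm : ∀ n, Measurable fun t => ∫ x, e (U x t) * cutoff (p n t) (q n t) (ε n) x := fun n => by
    have hS := Real.smoothTransition.continuous.measurable
    have hm : Measurable fun z : ℝ × ℝ =>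
        e (U z.2 z.1) * cutoff (p n z.1) (q n z.1) (ε n) z.2 :=
      (he.continuous.measurable.comp (hUm.comp measurable_swap)).mul
        ((hS.comp ((measurable_snd.sub
          ((hpsm n).continuous.measurable.comp measurable_fst)).div_const _)).sub
          (hS.comp ((measurable_snd.sub
            ((hqsm n).continuous.measurable.comp measurable_fst)).div_const _)))
    exact (hm.stronglyMeasurable.integral_prod_right' (ν := volume)).measurable
  have hIm : ∀ n, Measurable (I n) := fun n =>
    (hdψ.measurable.mul (hJm n)).add (hψ.continuous.measurable.mul
      (((hlay _ (hpsm n).continuous _ _ hG.continuous).sub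
        (((hP1 n).continuous_deriv (by simp)).measurable.mul
          (hlay _ (hpsm n).continuous _ _ he.continuous))).add
        ((((hQ1 n).continuous_deriv (by simp)).measurable.mul
          (hlay _ (hqsm n).continuous _ _ he.continuous)).sub
          (hlay _ (hqsm n).continuous _ _ hG.continuous))))
  set b : ℝ → ℝ := fun t => |deriv ψ t| * (Be * B) + |ψ t| * ((Bg + K * Be) + (K * Be + Bg)) with hb
  have hbi : Integrable b (volume.restrict (Ioi (0 : ℝ))) := by
    have h1 := hdψ.integrable_of_hasCompactSupport hψc.deriv (μ := volume)
    have h2 := hψ.continuous.integrable_of_hasCompactSupport hψc (μ := volume)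
    exact ((h1.abs.mul_const _).add (h2.abs.mul_const _)).integrableOn
  have hIb : ∀ n t, ‖I n t‖ ≤ b t := fun n t => by
    have a1 : |∫ x, e (U x t) * cutoff (p n t) (q n t) (ε n) x| ≤ Be * B := by
      refine (abs_integral_mul_cutoff_le (fun x => hBe x t) (hε0 n) (a := xL t) (b := xR t)
        ?_ ?_ ?_ ?_).trans (mul_le_mul_of_nonneg_left (hB t) hBe0) <;>
      linarith [hp1 n t, hp2 n t, hq1 n t, hq2 n t, hε0 n, hε8 n, hD t]
    have a2 : ∀ c, |L c (ε n) t G| ≤ Bg := fun c =>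
      abs_integral_layer_mul_le (hε0 n) fun x => hBg x t
    have a3 : ∀ c, |L c (ε n) t e| ≤ Be := fun c =>
      abs_integral_layer_mul_le (hε0 n) fun x => hBe x t
    have a4 : |deriv (P n) t * L (p n t) (ε n) t e| ≤ K * Be := by
      rw [abs_mul]; exact mul_le_mul (hP3 n t) (a3 _) (abs_nonneg _) K.coe_nonneg
    have a5 : |deriv (Q n) t * L (q n t) (ε n) t e| ≤ K * Be := by
      rw [abs_mul]; exact mul_le_mul (hQ3 n t) (a3 _) (abs_nonneg _) K.coe_nonneg
    refine (abs_add_le _ _).trans (add_le_add ?_ ?_)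
    · rw [abs_mul]; gcongr
    · rw [abs_mul]
      refine mul_le_mul_of_nonneg_left ((abs_add_le _ _).trans (add_le_add ?_ ?_)) (abs_nonneg _)
      · exact (abs_sub _ _).trans (add_le_add (a2 _) a4)
      · exact (abs_sub _ _).trans (add_le_add a5 (a2 _))
  have hconv := tendsto_integral_of_dominated_convergence b
    (fun n => (hIm n).aestronglyMeasurable) hbi (fun n => Eventually.of_forall (hIb n))
    (hl.mono fun t ht => ht.1)
  refine (ge_of_tendsto' hconv hI).trans (integral_mono_ae (hbi.mono' ?_ ?_) (hbi.mono' ?_ ?_)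
    (hl.mono fun t ht => ht.2))
  · exact aestronglyMeasurable_of_tendsto_ae _ (fun n => (hIm n).aestronglyMeasurable)
      (hl.mono fun t ht => ht.1)
  · filter_upwards [hl] with t ht
    exact le_of_tendsto' ht.1.norm fun n => hIb n t
  · exact (hdψ.measurable.mul hEm).aestronglyMeasurable
  · refine Eventually.of_forall fun t => ?_
    rw [norm_mul]
    have h1 := mul_le_mul_of_nonneg_left (abs_integral_between_le (fun x => hBe x t) hBe0
      (by linarith [hD t] : xL t ≤ xR t) (hB t)) (abs_nonneg (deriv ψ t))
    have h2 : 0 ≤ |ψ t| * ((Bg + K * Be) + (K * Be + Bg)) := by positivity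
    simp only [hb, Real.norm_eq_abs]
    linarith

section Flux

variable {A η : ℝ → ℝ}

theorem relEnt_self (η : ℝ → ℝ) (C : ℝ) : relEnt η C C = 0 := by simp [relEnt]

theorem relFlux_self (A η : ℝ → ℝ) (C : ℝ) : relFlux A η C C = 0 := by simp [relFlux]

theorem hasDerivAt_relEnt (hη : ContDiff ℝ (⊤ : ℕ∞) η) (C v : ℝ) :
    HasDerivAt (fun v => relEnt η v C) (deriv η v - deriv η C) v := by
  have h := ((hη.differentiable (by simp) v).hasDerivAt.sub_const (η C)).sub
    (((hasDerivAt_id v).sub_const C).const_mul (deriv η C))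
  exact h.congr_deriv (by ring)

theorem hasDerivAt_relFlux (hA : ContDiff ℝ (⊤ : ℕ∞) A) (hη : ContDiff ℝ (⊤ : ℕ∞) η) (C v : ℝ) :
    HasDerivAt (fun v => relFlux A η v C) ((deriv η v - deriv η C) * deriv A v) v := by
  have hc : Continuous fun w => (deriv η w - deriv η C) * deriv A w :=
    ((hη.continuous_deriv (by simp)).sub continuous_const).mul (hA.continuous_deriv (by simp))
  exact hc.integral_hasStrictDerivAt C v |>.hasDerivAt

theorem contDiff_relEnt (hη : ContDiff ℝ (⊤ : ℕ∞) η) (C : ℝ) :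
    ContDiff ℝ (⊤ : ℕ∞) fun v => relEnt η v C := by
  unfold relEnt; fun_prop

theorem contDiff_relFlux (hA : ContDiff ℝ (⊤ : ℕ∞) A) (hη : ContDiff ℝ (⊤ : ℕ∞) η) (C : ℝ) :
    ContDiff ℝ (⊤ : ℕ∞) fun v => relFlux A η v C := by
  refine contDiff_infty_iff_deriv.2
    ⟨fun v => (hasDerivAt_relFlux hA hη C v).differentiableAt, ?_⟩
  rw [funext fun v => (hasDerivAt_relFlux hA hη C v).deriv]
  exact ((contDiff_infty_iff_deriv.1 hη).2.sub contDiff_const).mul (contDiff_infty_iff_deriv.1 hA).2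

theorem strictMono_deriv (hconv : ∀ v, 0 < deriv (deriv η) v) : StrictMono (deriv η) :=
  strictMono_of_deriv_pos hconv

theorem relEnt_pos (hη : ContDiff ℝ (⊤ : ℕ∞) η) (hη' : StrictMono (deriv η)) {v C : ℝ}
    (h : v ≠ C) : 0 < relEnt η v C := by
  rcases lt_or_gt_of_ne h with h | h
  · obtain ⟨m, hm, hm'⟩ := exists_hasDerivAt_eq_slope (fun v => relEnt η v C) _ h
      (contDiff_relEnt hη C).continuous.continuousOn fun w _ => hasDerivAt_relEnt hη C w
    rw [relEnt_self, eq_div_iff (by linarith)] at hm'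
    nlinarith [hη' hm.2]
  · obtain ⟨m, hm, hm'⟩ := exists_hasDerivAt_eq_slope (fun v => relEnt η v C) _ h
      (contDiff_relEnt hη C).continuous.continuousOn fun w _ => hasDerivAt_relEnt hη C w
    rw [relEnt_self, eq_div_iff (by linarith)] at hm'
    nlinarith [hη' hm.1]

theorem relEnt_nonneg (hη : ContDiff ℝ (⊤ : ℕ∞) η) (hη' : StrictMono (deriv η)) (v C : ℝ) :
    0 ≤ relEnt η v C := by
  rcases eq_or_ne v C with rfl | h
  · rw [relEnt_self]
  · exact (relEnt_pos hη hη' h).le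

theorem exists_normFlux_eq_of_gt (hA : ContDiff ℝ (⊤ : ℕ∞) A) (hη : ContDiff ℝ (⊤ : ℕ∞) η)
    (hη' : StrictMono (deriv η)) {v C : ℝ} (h : C < v) :
    ∃ m ∈ Ioo C v, relFlux A η v C = deriv A m * relEnt η v C := by
  obtain ⟨m, hm, hm'⟩ := exists_ratio_hasDerivAt_eq_ratio_slope (fun v => relFlux A η v C) _ h
    (contDiff_relFlux hA hη C).continuous.continuousOn (fun w _ => hasDerivAt_relFlux hA hη C w)
    (fun v => relEnt η v C) _
    (contDiff_relEnt hη C).continuous.continuousOn (fun w _ => hasDerivAt_relEnt hη C w)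
  simp only [relEnt_self, relFlux_self, sub_zero] at hm'
  refine ⟨m, hm, mul_right_cancel₀ (sub_pos.2 (hη' hm.1)).ne' ?_⟩
  linarith

theorem exists_normFlux_eq_of_lt (hA : ContDiff ℝ (⊤ : ℕ∞) A) (hη : ContDiff ℝ (⊤ : ℕ∞) η)
    (hη' : StrictMono (deriv η)) {v C : ℝ} (h : v < C) :
    ∃ m ∈ Ioo v C, relFlux A η v C = deriv A m * relEnt η v C := by
  obtain ⟨m, hm, hm'⟩ := exists_ratio_hasDerivAt_eq_ratio_slope (fun v => relFlux A η v C) _ h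
    (contDiff_relFlux hA hη C).continuous.continuousOn (fun w _ => hasDerivAt_relFlux hA hη C w)
    (fun v => relEnt η v C) _
    (contDiff_relEnt hη C).continuous.continuousOn (fun w _ => hasDerivAt_relEnt hη C w)
  simp only [relEnt_self, relFlux_self, zero_sub] at hm'
  refine ⟨m, hm, mul_right_cancel₀ (sub_neg.2 (hη' hm.2)).ne ?_⟩
  linarith

theorem relEnt_change (η : ℝ → ℝ) (v C C' : ℝ) : relEnt η v C' =
    relEnt η v C + relEnt η C C' + (deriv η C - deriv η C') * (v - C) := by
  unfold relEnt; ring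

theorem relFlux_change (hA : ContDiff ℝ (⊤ : ℕ∞) A) (hη : ContDiff ℝ (⊤ : ℕ∞) η) (v C C' : ℝ) :
    relFlux A η v C' =
      relFlux A η v C + relFlux A η C C' + (deriv η C - deriv η C') * (A v - A C) := by
  have hA' := hA.continuous_deriv (by simp)
  have hc : ∀ c, Continuous fun w => (deriv η w - c) * deriv A w := fun c =>
    ((hη.continuous_deriv (by simp)).sub continuous_const).mul hA'
  have h1 : A v - A C = ∫ w in C..v, deriv A w :=
    (intervalIntegral.integral_deriv_eq_sub (fun w _ => hA.differentiable (by simp) w)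
      (hA'.intervalIntegrable _ _)).symm
  unfold relFlux
  rw [h1, ← intervalIntegral.integral_add_adjacent_intervals ((hc _).intervalIntegrable C' C)
    ((hc _).intervalIntegrable C v), ← intervalIntegral.integral_const_mul, add_comm, add_right_comm,
    ← intervalIntegral.integral_add ((hc _).intervalIntegrable _ _)
      ((hA'.const_mul _).intervalIntegrable _ _)]
  congr 2
  ext w; ring

/-- A Chebyshev inequality: the mean of `A'` between `C` and `v` lies between `A' C` and the
weighted mean `A' m`. -/
theorem mean_comparison (hA : ContDiff ℝ (⊤ : ℕ∞) A) (hη : ContDiff ℝ (⊤ : ℕ∞) η)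
    (hA' : StrictMono (deriv A)) (hη' : StrictMono (deriv η)) {v C m : ℝ}
    (hm : m ∈ Ioo C v ∨ m ∈ Ioo v C) (hF : relFlux A η v C = deriv A m * relEnt η v C) :
    A v - A C - deriv A m * (v - C) ≤ 0 := by
  have hB : Monotone fun w => relFlux A η w C - deriv A m * relEnt η w C +
      (deriv η C - deriv η m) * (A w - deriv A m * w) := by
    have hd : ∀ w, HasDerivAt (fun w => relFlux A η w C - deriv A m * relEnt η w C +
        (deriv η C - deriv η m) * (A w - deriv A m * w))
        ((deriv η w - deriv η m) * (deriv A w - deriv A m)) w := fun w =>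
      (((hasDerivAt_relFlux hA hη C w).sub ((hasDerivAt_relEnt hη C w).const_mul _)).add
        (((hA.differentiable (by simp) w).hasDerivAt.sub
          ((hasDerivAt_id w).const_mul (deriv A m))).const_mul _)).congr_deriv (by ring)
    refine monotone_of_deriv_nonneg (fun w => (hd w).differentiableAt) fun w => ?_
    rw [(hd w).deriv]
    rcases le_total w m with h | h
    · exact mul_nonneg_of_nonpos_of_nonpos (sub_nonpos.2 (hη'.monotone h))
        (sub_nonpos.2 (hA'.monotone h))
    · exact mul_nonneg (sub_nonneg.2 (hη'.monotone h)) (sub_nonneg.2 (hA'.monotone h))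
  rcases hm with hm | hm
  · have h := hB (hm.1.trans hm.2).le
    simp only [relFlux_self, relEnt_self] at h
    nlinarith [hη' hm.1]
  · have h := hB (hm.1.trans hm.2).le
    simp only [relFlux_self, relEnt_self] at h
    nlinarith [hη' hm.2]

theorem relFlux_le_of_normFlux_le (hη : ContDiff ℝ (⊤ : ℕ∞) η) (hη' : StrictMono (deriv η))
    {v C d : ℝ} (h : normFlux A η v C ≤ d) : relFlux A η v C ≤ d * relEnt η v C := by
  rcases eq_or_ne v C with rfl | hv
  · simp [relEnt_self, relFlux_self]
  · rwa [normFlux, if_neg hv, div_le_iff₀ (relEnt_pos hη hη' hv)] at h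

theorem le_relFlux_of_le_normFlux (hη : ContDiff ℝ (⊤ : ℕ∞) η) (hη' : StrictMono (deriv η))
    {v C d : ℝ} (h : d ≤ normFlux A η v C) : d * relEnt η v C ≤ relFlux A η v C := by
  rcases eq_or_ne v C with rfl | hv
  · simp [relEnt_self, relFlux_self]
  · rwa [normFlux, if_neg hv, le_div_iff₀ (relEnt_pos hη hη' hv)] at h

theorem normFlux_le_of_le (hA : ContDiff ℝ (⊤ : ℕ∞) A) (hη : ContDiff ℝ (⊤ : ℕ∞) η)
    (hA' : StrictMono (deriv A)) (hη' : StrictMono (deriv η)) {v C : ℝ} (h : C ≤ v) :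
    normFlux A η v C ≤ deriv A v := by
  rcases h.eq_or_lt with rfl | h
  · simp [normFlux]
  · obtain ⟨m, hm, hF⟩ := exists_normFlux_eq_of_gt hA hη hη' h
    rw [normFlux, if_neg h.ne', hF, mul_div_cancel_right₀ _ (relEnt_pos hη hη' h.ne').ne']
    exact (hA' hm.2).le

theorem le_normFlux_of_le (hA : ContDiff ℝ (⊤ : ℕ∞) A) (hη : ContDiff ℝ (⊤ : ℕ∞) η)
    (hA' : StrictMono (deriv A)) (hη' : StrictMono (deriv η)) {v C : ℝ} (h : v ≤ C) :
    deriv A v ≤ normFlux A η v C := by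
  rcases h.eq_or_lt with rfl | h
  · simp [normFlux]
  · obtain ⟨m, hm, hF⟩ := exists_normFlux_eq_of_lt hA hη hη' h
    rw [normFlux, if_neg h.ne, hF, mul_div_cancel_right₀ _ (relEnt_pos hη hη' h.ne).ne']
    exact (hA' hm.1).le

/-- The normalized relative entropy flux is monotone in the reference state. -/
theorem normFlux_mono (hA : ContDiff ℝ (⊤ : ℕ∞) A) (hη : ContDiff ℝ (⊤ : ℕ∞) η)
    (hA' : StrictMono (deriv A)) (hη' : StrictMono (deriv η)) {CL CR : ℝ} (h : CR < CL) (v : ℝ) :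
    normFlux A η v CR ≤ normFlux A η v CL := by
  have hηLR := hη' h
  rcases lt_or_ge CL v with hv | hv
  · obtain ⟨m, hm, hF⟩ := exists_normFlux_eq_of_gt hA hη hη' hv
    obtain ⟨m', hm', hF'⟩ := exists_normFlux_eq_of_gt hA hη hη' h
    have hQ := mean_comparison hA hη hA' hη' (Or.inl hm) hF
    have hvR : v ≠ CR := (h.trans hv).ne'
    rw [normFlux, normFlux, if_neg hv.ne', if_neg hvR, hF,
      mul_div_cancel_right₀ _ (relEnt_pos hη hη' hv.ne').ne', div_le_iff₀ (relEnt_pos hη hη' hvR),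
      relFlux_change hA hη v CL CR, relEnt_change η v CL CR, hF, hF']
    have h1 := mul_le_mul_of_nonneg_right (hA' (hm'.2.trans hm.1)).le (relEnt_nonneg hη hη' CL CR)
    nlinarith
  rcases lt_or_ge v CR with hv' | hv'
  · obtain ⟨m, hm, hF⟩ := exists_normFlux_eq_of_lt hA hη hη' hv'
    obtain ⟨m', hm', hF'⟩ := exists_normFlux_eq_of_lt hA hη hη' h
    have hQ := mean_comparison hA hη hA' hη' (Or.inr hm) hF
    have hvL : v ≠ CL := (hv'.trans h).ne
    rw [normFlux, normFlux, if_neg hv'.ne, if_neg hvL, hF,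
      mul_div_cancel_right₀ _ (relEnt_pos hη hη' hv'.ne).ne', le_div_iff₀ (relEnt_pos hη hη' hvL),
      relFlux_change hA hη v CR CL, relEnt_change η v CR CL, hF, hF']
    have h1 := mul_le_mul_of_nonneg_right (hA' (hm.2.trans hm'.1)).le (relEnt_nonneg hη hη' CR CL)
    nlinarith
  · exact (normFlux_le_of_le hA hη hA' hη' hv').trans (le_normFlux_of_le hA hη hA' hη' hv)

end Flux

/-- `t ↦ ∫ e(U(x, t)) dx` over a continuously moving interval is right-continuous. -/
theorem tendsto_integral_between {U : ℝ → ℝ → ℝ} (hU : Measurable fun p : ℝ × ℝ => U p.1 p.2)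
    {M : ℝ} (hM : ∀ x t, |U x t| ≤ M) (hcont : L1locCont U) {e : ℝ → ℝ}
    (he : ContDiff ℝ (⊤ : ℕ∞) e) {xL xR : ℝ → ℝ} (hxL : Continuous xL) (hxR : Continuous xR)
    {s : ℝ} (hs : 0 ≤ s) :
    Tendsto (fun t => ∫ x in xL t..xR t, e (U x t)) (𝓝[>] s)
      (𝓝 (∫ x in xL s..xR s, e (U x s))) := by
  obtain ⟨B, hB0, hB⟩ := exists_bound_comp he.continuous hM
  obtain ⟨L, hL⟩ := (isCompact_Icc (a := -M) (b := M)).exists_bound_of_continuousOn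
    (he.continuous_deriv (by simp)).continuousOn
  have hlip : ∀ x t, |e (U x t) - e (U x s)| ≤ L * |U x t - U x s| := fun x t =>
    (convex_Icc (-M) M).norm_image_sub_le_of_norm_deriv_le
      (fun v _ => he.differentiable (by simp) v) hL (abs_le.1 (hM x s)) (abs_le.1 (hM x t))
  have hUt : ∀ t, Measurable fun x => U x t := fun t =>
    hU.comp (measurable_id.prodMk measurable_const)
  have hint : ∀ t a b, IntervalIntegrable (fun x => e (U x t)) volume a b := fun t a b =>
    (intervalIntegrable_const (c := B)).mono_fun
      (he.continuous.measurable.comp (hUt t)).aestronglyMeasurable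
      (Eventually.of_forall fun x => (hB x t).trans (le_abs_self B))
  have hUint : ∀ t a b, IntervalIntegrable (fun x => |U x t - U x s|) volume a b := fun t a b =>
    (intervalIntegrable_const (c := M + M)).mono_fun
      ((hUt t).sub (hUt s)).abs.aestronglyMeasurable
      (Eventually.of_forall fun x => by
        exact (abs_abs _).trans_le (((abs_sub _ _).trans (add_le_add (hM x t) (hM x s))).trans
          (le_abs_self _)))
  set R := max |xL s| |xR s| + 1 with hR
  have hR0 : 0 < R := by positivity
  have hmem : ∀ {x : ℝ → ℝ}, Continuous x → |x s| < R → ∀ᶠ t in 𝓝[>] s, x t ∈ Icc (-R) R :=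
    fun hx h => by
      filter_upwards [nhdsWithin_le_nhds ((hx.abs.tendsto s).eventually (gt_mem_nhds h))] with t ht
      exact abs_le.1 ht.le
  have h1 : Tendsto (fun t => ∫ x in xL t..xR t, (e (U x t) - e (U x s))) (𝓝[>] s) (𝓝 0) := by
    have h0 := ((hcont R hR0 s hs).mono_left (nhdsWithin_mono s Ioi_subset_Ici_self)).const_mul L
    rw [mul_zero] at h0
    refine squeeze_zero_norm' ?_ h0
    filter_upwards [hmem hxL ((le_max_left _ _).trans_lt (lt_add_one _)),
      hmem hxR ((le_max_right _ _).trans_lt (lt_add_one _))] with t htL htR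
    have hsub : uIoc (xL t) (xR t) ⊆ Ioc (-R) R := by
      intro x hx
      rw [mem_uIoc] at hx
      rcases hx with hx | hx
      · exact ⟨htL.1.trans_lt hx.1, hx.2.trans htR.2⟩
      · exact ⟨htR.1.trans_lt hx.1, hx.2.trans htL.2⟩
    have hI : IntegrableOn (fun x => L * |U x t - U x s|) (Ioc (-R) R) :=
      (((hUint t (-R) R).const_mul L).1)
    refine intervalIntegral.norm_integral_le_integral_norm_uIoc.trans ?_
    rw [← intervalIntegral.integral_const_mul, intervalIntegral.integral_of_le (by linarith)]
    refine (setIntegral_mono (((hint t _ _).sub (hint s _ _)).def'.norm) (hI.mono_set hsub)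
      fun x => hlip x t).trans (setIntegral_mono_set hI ?_ hsub.eventuallyLE)
    exact Eventually.of_forall fun x => (abs_nonneg _).trans (hlip x t)
  have h2 : Tendsto (fun t => ∫ x in xL t..xR t, e (U x s)) (𝓝[>] s)
      (𝓝 (∫ x in xL s..xR s, e (U x s))) := by
    have hc := intervalIntegral.continuous_primitive (hint s) 0
    have h : Tendsto (fun t => (∫ x in 0..xR t, e (U x s)) - ∫ x in 0..xL t, e (U x s)) (𝓝 s)
        (𝓝 ((∫ x in 0..xR s, e (U x s)) - ∫ x in 0..xL s, e (U x s))) :=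
      ((hc.comp hxR).sub (hc.comp hxL)).tendsto s
    simp only [intervalIntegral.integral_interval_sub_left (hint s _ _) (hint s _ _)] at h
    exact h.mono_left nhdsWithin_le_nhds
  refine ((h1.add h2).congr fun t => ?_).trans_eq (by rw [zero_add])
  rw [intervalIntegral.integral_sub (hint t _ _) (hint s _ _)]
  ring

/-- The entropy between two curves which it does not enter decreases in time. -/
theorem integral_between_anti {A : ℝ → ℝ} {U Um Up : ℝ → ℝ → ℝ}
    (hsol : IsEntropySol A U) (hlim : HasSideLimits U Um Up) (hcont : L1locCont U) {e G : ℝ → ℝ}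
    (he : ContDiff ℝ (⊤ : ℕ∞) e) (hG : ContDiff ℝ (⊤ : ℕ∞) G) (he2 : ∀ v, 0 ≤ deriv (deriv e) v)
    (hGe : ∀ v, deriv G v = deriv e v * deriv A v) {xL xR : ℝ → ℝ} {K : NNReal}
    (hxL : LipschitzWith K xL) (hxR : LipschitzWith K xR) {δ B : ℝ} (hδ : 0 < δ)
    (hD : ∀ t, δ ≤ xR t - xL t) (hB : ∀ t, xR t - xL t ≤ B) {t₀ T : ℝ} (ht₀ : 0 ≤ t₀)
    (hbd : ∀ᵐ t ∂volume.restrict (Icc t₀ T), ∃ dL dR, HasDerivAt xL dL t ∧ HasDerivAt xR dR t ∧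
      G (Up (xL t) t) ≤ dL * e (Up (xL t) t) ∧ dR * e (Um (xR t) t) ≤ G (Um (xR t) t))
    {s τ : ℝ} (hs : t₀ ≤ s) (hsτ : s < τ) (hτ : τ < T) :
    ∫ x in xL τ..xR τ, e (U x τ) ≤ ∫ x in xL s..xR s, e (U x s) := by
  obtain ⟨M, hM⟩ := hsol.bounded
  obtain ⟨C, hC0, hC⟩ := exists_bound_comp he.continuous hM
  have hle : ∀ t, xL t ≤ xR t := fun t => by linarith [hD t]
  set E : ℝ → ℝ := fun t => ∫ x in xL t..xR t, e (U x t) with hE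
  have hEm : Measurable E := measurable_integral_between (he.continuous.measurable.comp
    hsol.measurable) hxL.continuous.measurable hxR.continuous.measurable hle
  have hEB : ∀ t, |E t| ≤ C * B := fun t =>
    abs_integral_between_le (fun x => hC x t) hC0 (hle t) (hB t)
  obtain ⟨ε, -, hε, hε0⟩ := exists_seq_strictAnti_tendsto' (sub_pos.2 hτ)
  have hlim' : ∀ r, t₀ ≤ r → Tendsto (fun n => ∫ t, layer r (ε n) t * E t) atTop (𝓝 (E r)) :=
    fun r hr => tendsto_integral_layer_mul hEm hEB
      (tendsto_integral_between hsol.measurable hM hcont he hxL.continuous hxR.continuous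
        (ht₀.trans hr)) (fun n => (hε n).1) fun u hu => tendsto_nhdsWithin_iff.2
      ⟨by simpa using (hε0.mul_const u).const_add r, Eventually.of_forall fun n =>
        lt_add_of_pos_right r (mul_pos (hε n).1 hu.1)⟩
  refine sub_nonneg.1 (ge_of_tendsto' ((hlim' s hs).sub (hlim' τ (hs.trans hsτ.le))) fun n => ?_)
  have hn := (hε n).1
  have hn' := (hε n).2
  have hd : ∀ t, deriv (fun t => cutoff s τ (ε n) t) t = layer s (ε n) t - layer τ (ε n) t :=
    fun t => (hasDerivAt_cutoff _ _ _ t).deriv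
  have key := integral_deriv_mul_entropy_nonneg hsol hlim he hG he2 hGe hxL hxR hδ hD hB ht₀ hbd
    (ψ := fun t => cutoff s τ (ε n) t)
    ((Real.smoothTransition.contDiff.comp ((contDiff_id.sub contDiff_const).div_const _)).sub
      (Real.smoothTransition.contDiff.comp ((contDiff_id.sub contDiff_const).div_const _)))
    (fun t => cutoff_nonneg hn hsτ.le t)
    (fun t => cutoff_eq_zero hn hs (hs.trans hsτ.le) (by linarith) (by linarith))
  rw [← integral_sub (integrable_layer_mul hn hEm hEB) (integrable_layer_mul hn hEm hEB)]
  refine key.trans_eq ?_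
  rw [← integral_Ici_eq_integral_Ioi, setIntegral_eq_integral_of_forall_compl_eq_zero]
  · simp only [hd, sub_mul, hE]
  · intro t ht
    rw [hd, layer_eq_zero hn fun h => ht (ht₀.trans (hs.trans h.1)),
      layer_eq_zero hn fun h => ht (ht₀.trans (hs.trans (hsτ.le.trans h.1))), sub_zero, zero_mul]

/-- **Lemma 3.5.** There is `1 < κ < ∞` such that for any `δ > 0`, if `x_L, x_R` are
Filippov solutions of the differential inclusions on `[t₀, T]` with
`x_R(t₀) - x_L(t₀) = δ` and `x_R(t) - x_L(t) ≥ δ` on `[t₀, T]`, then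
`x_R(t) - x_L(t) ≤ κ δ` on `[t₀, T]`. -/
theorem separation_growth_bound
    (A : ℝ → ℝ) (hA : ContDiff ℝ (⊤ : ℕ∞) A) (hA'' : ∀ x, 0 < deriv (deriv A) x)
    (U Um Up : ℝ → ℝ → ℝ)
    (hsol : IsEntropySol A U) (hlim : HasSideLimits U Um Up) (hcont : L1locCont U)
    (η : ℝ → ℝ) (hη : ContDiff ℝ (⊤ : ℕ∞) η) (hconv : ∀ v, 0 < deriv (deriv η) v)
    (CL CR : ℝ) (hLR : CR < CL) :
    ∃ κ : ℝ, 1 < κ ∧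
      ∀ δ : ℝ, 0 < δ → ∀ t₀ T : ℝ, 0 ≤ t₀ → t₀ < T →
      ∀ xL xR : ℝ → ℝ,
        IsFilippov A η Um Up CL (Icc t₀ T) xL → IsFilippov A η Um Up CR (Icc t₀ T) xR →
        xR t₀ - xL t₀ = δ → (∀ t ∈ Icc t₀ T, δ ≤ xR t - xL t) →
        ∀ t ∈ Icc t₀ T, xR t - xL t ≤ κ * δ := by
  have hA' := strictMono_deriv hA''
  have hη' := strictMono_deriv hconv
  obtain ⟨M, hM⟩ := hsol.bounded
  set e : ℝ → ℝ := fun v => relEnt η v CL + relEnt η v CR with he_def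
  set G : ℝ → ℝ := fun v => relFlux A η v CL + relFlux A η v CR with hG_def
  have he : ContDiff ℝ (⊤ : ℕ∞) e := (contDiff_relEnt hη CL).add (contDiff_relEnt hη CR)
  have hG : ContDiff ℝ (⊤ : ℕ∞) G := (contDiff_relFlux hA hη CL).add (contDiff_relFlux hA hη CR)
  have hed : deriv e = fun v => deriv η v - deriv η CL + (deriv η v - deriv η CR) :=
    funext fun v => ((hasDerivAt_relEnt hη CL v).add (hasDerivAt_relEnt hη CR v)).deriv
  have he2 : ∀ v, 0 ≤ deriv (deriv e) v := fun v => by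
    have h := ((contDiff_infty_iff_deriv.1 hη).2.differentiable (by simp) v).hasDerivAt
    rw [hed]
    exact (add_pos (hconv v) (hconv v)).le.trans_eq
      ((h.sub_const (deriv η CL)).add (h.sub_const (deriv η CR))).deriv.symm
  have hGe : ∀ v, deriv G v = deriv e v * deriv A v := fun v => by
    rw [hed]
    exact ((hasDerivAt_relFlux hA hη CL v).add (hasDerivAt_relFlux hA hη CR v)).deriv.trans
      (add_mul _ _ _).symm
  have hepos : ∀ v, 0 < e v := fun v => by
    rcases eq_or_ne v CL with rfl | hv
    · exact add_pos_of_nonneg_of_pos (relEnt_nonneg hη hη' _ _) (relEnt_pos hη hη' hLR.ne')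
    · exact add_pos_of_pos_of_nonneg (relEnt_pos hη hη' hv) (relEnt_nonneg hη hη' _ _)
  have hM0 : 0 ≤ M := (abs_nonneg _).trans (hM 0 0)
  obtain ⟨v₀, -, hv₀⟩ := (isCompact_Icc (a := -M) (b := M)).exists_isMinOn
    (nonempty_Icc.2 (by linarith)) he.continuous.continuousOn
  have hc0 := hepos v₀
  obtain ⟨C, hC0, hC⟩ := exists_bound_comp he.continuous hM
  refine ⟨C / e v₀ + 2, by linarith [div_nonneg hC0 hc0.le], ?_⟩
  rintro δ hδ t₀ T ht₀ htT xL xR ⟨⟨KL, hKL⟩, hFL⟩ ⟨⟨KR, hKR⟩, hFR⟩ h0 hD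
  set yL : ℝ → ℝ := fun t => xL (projIcc t₀ T htT.le t) with hyL_def
  set yR : ℝ → ℝ := fun t => xR (projIcc t₀ T htT.le t) with hyR_def
  have hy : ∀ t ∈ Icc t₀ T, (projIcc t₀ T htT.le t : ℝ) = t := fun t ht => by
    rw [projIcc_of_mem htT.le ht]
  have hyL : LipschitzWith (max KL KR) yL :=
    (hKL.to_restrict.comp (LipschitzWith.projIcc htT.le)).weaken (by simp)
  have hyR : LipschitzWith (max KL KR) yR :=
    (hKR.to_restrict.comp (LipschitzWith.projIcc htT.le)).weaken (by simp)
  have hDy : ∀ t, δ ≤ yR t - yL t := fun t => hD _ (projIcc t₀ T htT.le t).2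
  have hcD : ContinuousOn (fun t => xR t - xL t) (Icc t₀ T) := hKR.continuousOn.sub hKL.continuousOn
  obtain ⟨B, hB⟩ := isCompact_Icc.exists_bound_of_continuousOn hcD
  have hBy : ∀ t, yR t - yL t ≤ B := fun t =>
    (le_abs_self _).trans (hB _ (projIcc t₀ T htT.le t).2)
  have hbd : ∀ᵐ t ∂volume.restrict (Icc t₀ T), ∃ dL dR, HasDerivAt yL dL t ∧
      HasDerivAt yR dR t ∧ G (Up (yL t) t) ≤ dL * e (Up (yL t) t) ∧
      dR * e (Um (yR t) t) ≤ G (Um (yR t) t) := by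
    have hIoo : ∀ᵐ t ∂volume.restrict (Icc t₀ T), t ∈ Ioo t₀ T := by
      rw [← restrict_Ioo_eq_restrict_Icc]
      exact ae_restrict_mem measurableSet_Ioo
    filter_upwards [hFL, hFR, hIoo] with t htL htR ht
    obtain ⟨dL, hdL, hL, -⟩ := htL
    obtain ⟨dR, hdR, -, hR⟩ := htR
    have hyt := hy t (Ioo_subset_Icc_self ht)
    have hev : ∀ᶠ u in 𝓝 t, (projIcc t₀ T htT.le u : ℝ) = u := by
      filter_upwards [isOpen_Ioo.mem_nhds ht] with u hu using hy u (Ioo_subset_Icc_self hu)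
    refine ⟨dL, dR, hdL.congr_of_eventuallyEq (hev.mono fun u hu => congrArg xL hu),
      hdR.congr_of_eventuallyEq (hev.mono fun u hu => congrArg xR hu), ?_, ?_⟩
    · simp only [hyL_def, hyt, he_def, hG_def, mul_add]
      exact add_le_add (relFlux_le_of_normFlux_le hη hη' hL) (relFlux_le_of_normFlux_le hη hη'
        ((normFlux_mono hA hη hA' hη' hLR _).trans hL))
    · simp only [hyR_def, hyt, he_def, hG_def, mul_add]
      exact add_le_add (le_relFlux_of_le_normFlux hη hη' (hR.trans
        (normFlux_mono hA hη hA' hη' hLR _))) (le_relFlux_of_le_normFlux hη hη' hR)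
  have hIco : ∀ t ∈ Ico t₀ T, xR t - xL t ≤ (C / e v₀ + 2) * δ := fun t ht => by
    have hanti : ∫ x in yL t..yR t, e (U x t) ≤ ∫ x in yL t₀..yR t₀, e (U x t₀) := by
      rcases ht.1.eq_or_lt with rfl | h
      · exact le_rfl
      · exact integral_between_anti hsol hlim hcont he hG he2 hGe hyL hyR hδ hDy hBy ht₀ hbd le_rfl
          h ht.2
    have hle : ∀ t, yL t ≤ yR t := fun t => by linarith [hDy t]
    have hlow : (yR t - yL t) * e v₀ ≤ ∫ x in yL t..yR t, e (U x t) := by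
      rw [← smul_eq_mul, ← intervalIntegral.integral_const]
      refine intervalIntegral.integral_mono_on (hle t) intervalIntegrable_const
        ((intervalIntegrable_const (c := C)).mono_fun (he.continuous.measurable.comp
          (hsol.measurable.comp (measurable_id.prodMk measurable_const))).aestronglyMeasurable
          (Eventually.of_forall fun x => (hC x t).trans (le_abs_self C)))
        fun x _ => hv₀ (abs_le.1 (hM x t))
    have hy0 : yR t₀ - yL t₀ = δ := by
      simp only [hyL_def, hyR_def, hy t₀ (left_mem_Icc.2 htT.le), h0]
    have hup := (le_abs_self _).trans
      (abs_integral_between_le (fun x => hC x t₀) hC0 (hle t₀) hy0.le)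
    simp only [hyL_def, hyR_def, hy t (Ico_subset_Icc_self ht)] at hlow hanti hup
    have h : xR t - xL t ≤ C * δ / e v₀ :=
      (le_div_iff₀ hc0).2 (hlow.trans (hanti.trans hup))
    have h' : C * δ / e v₀ = C / e v₀ * δ := by ring
    linarith
  rw [← closure_Ico htT.ne] at hcD ⊢
  exact fun t ht => le_on_closure hIco hcD continuousOn_const ht
end
end

section
/- Let U be a bounded entropy solution of ∂_t U + ∂_x A(U) = 0 admitting one-sided spatial limits, and assume the set-valued map (x,t) ↦ [U(x+,t), U(x−,t)] is upper semicontinuous on ℝ × (0,∞). Let g : ℝ → ℝ be continuous and non-decreasing. Then for every (x₀,t₀) ∈ ℝ × [0,∞) there exists a Lipschitz continuous function x : [t₀,∞) → ℝ with x(t₀) = x₀ satisfying, for almost every t ≥ t₀, the differential inclusion ẋ(t) ∈ [g(U(x(t)+,t)), g(U(x(t)−,t))]. Moreover, if t₀ > 0, g is Lipschitz on bounded subsets of ℝ, and U satisfies the Oleinik one-sided estimate U(x,t) − U(y,t) ≤ (x − y)/(αt) for all x > y and t > 0 with α := inf A″ > 0, then this solution is unique. -/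
open MeasureTheory Set Filter Topology

noncomputable section

/-- The explicit Euler scheme with step `h` for the field `v`, started from `x₀` at time `t₀`. -/
def eulerSeq (v : ℝ → ℝ → ℝ) (x₀ t₀ h : ℝ) : ℕ → ℝ
  | 0 => x₀
  | k + 1 => eulerSeq v x₀ t₀ h k + h * v (eulerSeq v x₀ t₀ h k) (t₀ + k * h)

lemma eulerSeq_sub_bounds {v : ℝ → ℝ → ℝ} {x₀ t₀ h m M : ℝ} (hh : 0 ≤ h) {j k : ℕ} (hjk : j ≤ k)
    (H : ∀ i, j ≤ i → i < k → m ≤ v (eulerSeq v x₀ t₀ h i) (t₀ + i * h) ∧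
      v (eulerSeq v x₀ t₀ h i) (t₀ + i * h) ≤ M) :
    ((k : ℝ) - j) * h * m ≤ eulerSeq v x₀ t₀ h k - eulerSeq v x₀ t₀ h j ∧
      eulerSeq v x₀ t₀ h k - eulerSeq v x₀ t₀ h j ≤ ((k : ℝ) - j) * h * M := by
  induction k, hjk using Nat.le_induction with
  | base => simp
  | succ k hjk ih =>
    obtain ⟨h1, h2⟩ := ih fun i hi hik => H i hi (by omega)
    obtain ⟨h3, h4⟩ := H k hjk (by omega)
    have h5 := mul_le_mul_of_nonneg_left h3 hh
    have h6 := mul_le_mul_of_nonneg_left h4 hh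
    push_cast
    simp only [eulerSeq]
    constructor <;> linarith

lemma abs_eulerSeq_sub_le {v : ℝ → ℝ → ℝ} {x₀ t₀ h L : ℝ} (hh : 0 ≤ h)
    (hv : ∀ y s, |v y s| ≤ L) {j k : ℕ} (hjk : j ≤ k) :
    |eulerSeq v x₀ t₀ h k - eulerSeq v x₀ t₀ h j| ≤ ((k : ℝ) - j) * h * L := by
  obtain ⟨h1, h2⟩ := eulerSeq_sub_bounds (v := v) (x₀ := x₀) (t₀ := t₀) (m := -L) (M := L) hh hjk
    fun i _ _ => abs_le.1 (hv _ _)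
  rw [abs_le]
  constructor <;> linarith

/-- The piecewise constant interpolation of the Euler scheme with step `1 / (n + 1)`. -/
def eulerStep (v : ℝ → ℝ → ℝ) (x₀ t₀ : ℝ) (n : ℕ) (t : ℝ) : ℝ :=
  eulerSeq v x₀ t₀ (1 / ((n : ℝ) + 1)) ⌊(t - t₀) * ((n : ℝ) + 1)⌋₊

lemma tendsto_floor_mul_sub {t₀ s t : ℝ} (hs : t₀ ≤ s) (ht : t₀ ≤ t) :
    Tendsto (fun n : ℕ => ((⌊(t - t₀) * ((n : ℝ) + 1)⌋₊ : ℝ) - ⌊(s - t₀) * ((n : ℝ) + 1)⌋₊) *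
      (1 / ((n : ℝ) + 1))) atTop (𝓝 (t - s)) := by
  have hn : Tendsto (fun n : ℕ => (n : ℝ) + 1) atTop atTop :=
    tendsto_atTop_add_const_right _ _ tendsto_natCast_atTop_atTop
  have h1 := (tendsto_nat_floor_mul_div_atTop (sub_nonneg.2 ht)).comp hn
  have h2 := (tendsto_nat_floor_mul_div_atTop (sub_nonneg.2 hs)).comp hn
  have h3 := h1.sub h2
  rw [show t - t₀ - (s - t₀) = t - s by ring] at h3
  refine h3.congr fun n => ?_
  simp only [Function.comp]
  ring

lemma floor_mul_le_floor_mul {t₀ s t : ℝ} (hst : s ≤ t) (n : ℕ) :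
    ⌊(s - t₀) * ((n : ℝ) + 1)⌋₊ ≤ ⌊(t - t₀) * ((n : ℝ) + 1)⌋₊ :=
  Nat.floor_mono (mul_le_mul_of_nonneg_right (by linarith) (by positivity))

/-- A limit of Euler schemes along an ultrafilter moves, on short time intervals, with average
speed close to the values that the field takes near the current position. -/
lemma eulerStep_limit_bounds {v : ℝ → ℝ → ℝ} {L x₀ t₀ : ℝ} {l : Filter ℕ} [l.NeBot]
    (hl : l ≤ atTop) (hv : ∀ y s, |v y s| ≤ L) {x : ℝ → ℝ}
    (hx : ∀ t, t₀ ≤ t → Tendsto (fun n => eulerStep v x₀ t₀ n t) l (𝓝 (x t)))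
    {t b m M δ : ℝ} (ht₀ : t₀ ≤ t) (ht : 0 < t) (htb : t ≤ b) (hδ : 0 < δ)
    (hbδ : b < t + δ) (hbL : L * (b - t) < δ / 4)
    (H : ∀ y s, 0 < s → |y - x t| < δ → |s - t| < δ → m ≤ v y s ∧ v y s ≤ M) :
    (b - t) * m ≤ x b - x t ∧ x b - x t ≤ (b - t) * M := by
  have hL : 0 ≤ L := (abs_nonneg _).trans (hv 0 0)
  have hfl := (tendsto_floor_mul_sub ht₀ (ht₀.trans htb)).mono_left hl
  have hsub := (hx b (ht₀.trans htb)).sub (hx t ht₀)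
  have hstep : Tendsto (fun n : ℕ => 1 / ((n : ℝ) + 1)) l (𝓝 0) :=
    tendsto_one_div_add_atTop_nhds_zero_nat.mono_left hl
  have hclose : ∀ᶠ n in l, |eulerStep v x₀ t₀ n t - x t| < δ / 2 := by
    have := (tendsto_iff_dist_tendsto_zero.1 (hx t ht₀)).eventually (gt_mem_nhds (half_pos hδ))
    simpa only [Real.dist_eq] using this
  have hlen : ∀ᶠ n : ℕ in l, ((⌊(b - t₀) * ((n : ℝ) + 1)⌋₊ : ℝ) - ⌊(t - t₀) * ((n : ℝ) + 1)⌋₊) *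
      (1 / ((n : ℝ) + 1)) * L < δ / 4 :=
    (hfl.mul_const L).eventually (gt_mem_nhds (by linarith))
  have key : ∀ᶠ n : ℕ in l,
      ((⌊(b - t₀) * ((n : ℝ) + 1)⌋₊ : ℝ) - ⌊(t - t₀) * ((n : ℝ) + 1)⌋₊) * (1 / ((n : ℝ) + 1)) * m ≤
        eulerStep v x₀ t₀ n b - eulerStep v x₀ t₀ n t ∧
      eulerStep v x₀ t₀ n b - eulerStep v x₀ t₀ n t ≤
        ((⌊(b - t₀) * ((n : ℝ) + 1)⌋₊ : ℝ) - ⌊(t - t₀) * ((n : ℝ) + 1)⌋₊) *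
          (1 / ((n : ℝ) + 1)) * M := by
    filter_upwards [hclose, hlen, hstep.eventually (gt_mem_nhds hδ),
      hstep.eventually (gt_mem_nhds ht)] with n h1 h2 h3 h4
    have hn : (0 : ℝ) < (n : ℝ) + 1 := by positivity
    have hN : (0 : ℝ) < 1 / ((n : ℝ) + 1) := by positivity
    have hNn : ((n : ℝ) + 1) * (1 / ((n : ℝ) + 1)) = 1 := by field_simp
    refine eulerSeq_sub_bounds hN.le (floor_mul_le_floor_mul htb n) fun i hji hik => ?_
    have hi1 : (i : ℝ) ≤ (b - t₀) * ((n : ℝ) + 1) :=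
      (Nat.le_floor_iff (mul_nonneg (by linarith) hn.le)).1 hik.le
    have hi2 : (t - t₀) * ((n : ℝ) + 1) < (i : ℝ) + 1 :=
      (Nat.lt_floor_add_one _).trans_le (by gcongr)
    have hi3 : (i : ℝ) * (1 / ((n : ℝ) + 1)) ≤ b - t₀ := by
      have := mul_le_mul_of_nonneg_right hi1 hN.le
      rwa [mul_assoc, hNn, mul_one] at this
    have hi4 : t - t₀ < (i : ℝ) * (1 / ((n : ℝ) + 1)) + 1 / ((n : ℝ) + 1) := by
      have := mul_lt_mul_of_pos_right hi2 hN
      rwa [mul_assoc, hNn, mul_one, add_mul, one_mul] at this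
    have hi5 := abs_eulerSeq_sub_le (v := v) (x₀ := x₀) (t₀ := t₀) hN.le hv hji
    have hi6 : ((i : ℝ) - ⌊(t - t₀) * ((n : ℝ) + 1)⌋₊) * (1 / ((n : ℝ) + 1)) * L ≤
        ((⌊(b - t₀) * ((n : ℝ) + 1)⌋₊ : ℝ) - ⌊(t - t₀) * ((n : ℝ) + 1)⌋₊) *
          (1 / ((n : ℝ) + 1)) * L := by
      gcongr
    refine H _ _ (by linarith) ?_ (abs_lt.2 ⟨by linarith, by linarith⟩)
    have hi7 := abs_sub_le (eulerSeq v x₀ t₀ (1 / ((n : ℝ) + 1)) i) (eulerStep v x₀ t₀ n t) (x t)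
    have hi8 : |eulerSeq v x₀ t₀ (1 / ((n : ℝ) + 1)) i - eulerStep v x₀ t₀ n t| ≤ _ := hi5
    linarith
  exact ⟨le_of_tendsto_of_tendsto (hfl.mul_const m) hsub (key.mono fun n h => h.1),
    le_of_tendsto_of_tendsto hsub (hfl.mul_const M) (key.mono fun n h => h.2)⟩

/-- Peano-type existence for a scalar differential inclusion `ẋ ∈ [lo, hi]` admitting a bounded
selection `v` whose values near `(y, t)` are close to `[lo y t, hi y t]`. -/
theorem exists_lipschitz_solution_of_selection {v lo hi : ℝ → ℝ → ℝ} {L : ℝ}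
    (hv : ∀ y s, |v y s| ≤ L)
    (H : ∀ y t, 0 < t → ∀ ε > 0, ∃ δ > 0, ∀ z s, 0 < s → |z - y| < δ → |s - t| < δ →
      lo y t - ε ≤ v z s ∧ v z s ≤ hi y t + ε)
    (x₀ t₀ : ℝ) (ht₀ : 0 ≤ t₀) :
    ∃ x : ℝ → ℝ, (∃ K : NNReal, LipschitzOnWith K x (Ici t₀)) ∧ x t₀ = x₀ ∧
      ∀ᵐ t ∂(volume.restrict (Ioi t₀)), ∃ d, HasDerivAt x d t ∧ lo (x t) t ≤ d ∧ d ≤ hi (x t) t := by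
  have hL : 0 ≤ L := (abs_nonneg _).trans (hv 0 0)
  have hex : ∀ t, ∃ y, t₀ ≤ t → Tendsto (fun n => eulerStep v x₀ t₀ n t) (hyperfilter ℕ) (𝓝 y) := by
    intro t
    by_cases ht : t₀ ≤ t
    swap
    · exact ⟨0, fun h => absurd h ht⟩
    have hmem : ∀ n, eulerStep v x₀ t₀ n t ∈
        Icc (x₀ - (t - t₀) * L) (x₀ + (t - t₀) * L) := by
      intro n
      have hn : (0 : ℝ) < (n : ℝ) + 1 := by positivity
      have h1 := abs_eulerSeq_sub_le (v := v) (x₀ := x₀) (t₀ := t₀) (h := 1 / ((n : ℝ) + 1))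
        (by positivity) hv (Nat.zero_le ⌊(t - t₀) * ((n : ℝ) + 1)⌋₊)
      have h2 : (⌊(t - t₀) * ((n : ℝ) + 1)⌋₊ : ℝ) * (1 / ((n : ℝ) + 1)) ≤ t - t₀ := by
        rw [mul_one_div, div_le_iff₀ hn]
        exact Nat.floor_le (mul_nonneg (by linarith) hn.le)
      have h3 := mul_le_mul_of_nonneg_right h2 hL
      simp only [Nat.cast_zero, sub_zero, eulerSeq] at h1
      rw [abs_le] at h1
      exact ⟨by rw [eulerStep]; linarith, by rw [eulerStep]; linarith⟩
    obtain ⟨y, -, hy⟩ := (isCompact_Icc (a := x₀ - (t - t₀) * L)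
      (b := x₀ + (t - t₀) * L)).ultrafilter_le_nhds
        ((hyperfilter ℕ).map fun n => eulerStep v x₀ t₀ n t)
        (le_principal_iff.2 (Filter.mem_map.2 (univ_mem' hmem)))
    exact ⟨y, fun _ => hy⟩
  choose x hx using hex
  have hLip : LipschitzOnWith L.toNNReal x (Ici t₀) := by
    refine LipschitzOnWith.of_le_add_mul _ fun s hs t ht => ?_
    rw [Real.coe_toNNReal _ hL]
    rw [mem_Ici] at hs ht
    rcases le_total s t with hst | hst
    · have hlim := ((tendsto_floor_mul_sub hs ht).mono_left Nat.hyperfilter_le_atTop).mul_const L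
      have h1 := le_of_tendsto_of_tendsto ((hx t ht).sub (hx s hs)).abs hlim
        (Eventually.of_forall fun n =>
          abs_eulerSeq_sub_le (by positivity) hv (floor_mul_le_floor_mul hst n))
      have h2 := neg_abs_le (x t - x s)
      rw [dist_comm, Real.dist_eq, abs_of_nonneg (by linarith : 0 ≤ t - s)]
      linarith
    · have hlim := ((tendsto_floor_mul_sub ht hs).mono_left Nat.hyperfilter_le_atTop).mul_const L
      have h1 := le_of_tendsto_of_tendsto ((hx s hs).sub (hx t ht)).abs hlim
        (Eventually.of_forall fun n =>
          abs_eulerSeq_sub_le (by positivity) hv (floor_mul_le_floor_mul hst n))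
      have h2 := le_abs_self (x s - x t)
      rw [Real.dist_eq, abs_of_nonneg (by linarith : 0 ≤ s - t)]
      linarith
  refine ⟨x, ⟨_, hLip⟩, ?_, ?_⟩
  · refine tendsto_nhds_unique (hx t₀ le_rfl) ?_
    simp [eulerStep, eulerSeq]
  · rw [ae_restrict_iff' measurableSet_Ioi]
    filter_upwards [hLip.ae_differentiableWithinAt_of_mem] with t hdiff ht
    have htt : t₀ < t := ht
    have hd := ((hdiff htt.le).differentiableAt (Ici_mem_nhds htt)).hasDerivAt
    have hslope : Tendsto (slope x t) (𝓝[>] t) (𝓝 (deriv x t)) :=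
      (hasDerivAt_iff_tendsto_slope.1 hd).mono_left (nhdsWithin_mono _ fun y hy => ne_of_gt hy)
    have hbound : ∀ ε > 0, lo (x t) t - ε ≤ deriv x t ∧ deriv x t ≤ hi (x t) t + ε := by
      intro ε hε
      obtain ⟨δ, hδ, hδH⟩ := H (x t) t (ht₀.trans_lt htt) ε hε
      have hev1 : ∀ᶠ b in 𝓝[>] t, b < t + δ :=
        nhdsWithin_le_nhds (gt_mem_nhds (by linarith))
      have hev2 : ∀ᶠ b in 𝓝[>] t, L * (b - t) < δ / 4 := by
        have hc : Continuous fun b : ℝ => L * (b - t) := by fun_prop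
        exact nhdsWithin_le_nhds (hc.continuousAt.eventually_lt_const (by simp [hδ]))
      have hev : ∀ᶠ b in 𝓝[>] t, lo (x t) t - ε ≤ slope x t b ∧ slope x t b ≤ hi (x t) t + ε := by
        filter_upwards [hev1, hev2, self_mem_nhdsWithin] with b h1 h2 h3
        rw [mem_Ioi] at h3
        obtain ⟨h4, h5⟩ := eulerStep_limit_bounds Nat.hyperfilter_le_atTop hv hx htt.le
          (ht₀.trans_lt htt) h3.le hδ h1 h2 hδH
        rw [slope_def_field, le_div_iff₀ (by linarith), div_le_iff₀ (by linarith)]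
        constructor <;> linarith
      exact ⟨ge_of_tendsto hslope (hev.mono fun b h => h.1),
        le_of_tendsto hslope (hev.mono fun b h => h.2)⟩
    exact ⟨_, hd, le_of_forall_pos_le_add fun ε hε => by linarith [(hbound ε hε).1],
      le_of_forall_pos_le_add fun ε hε => (hbound ε hε).2⟩

/-- An absolutely continuous function vanishing at `a` and satisfying `w w' ≤ C w²` almost
everywhere vanishes on `[a, b]`. -/
theorem AbsolutelyContinuousOnInterval.eq_zero_of_mul_deriv_le {w : ℝ → ℝ} {a b C : ℝ}
    (hab : a ≤ b) (hw : AbsolutelyContinuousOnInterval w a b) (hwa : w a = 0)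
    (h : ∀ᵐ t ∂(volume.restrict (Ioi a)), ∃ d, HasDerivAt w d t ∧ w t * d ≤ C * w t ^ 2) :
    w b = 0 := by
  set e : ℝ → ℝ := fun t => Real.exp (-(2 * C) * t) with he
  have hed : ∀ t, HasDerivAt e (Real.exp (-(2 * C) * t) * (-(2 * C))) t := fun t => by
    simpa [he] using ((hasDerivAt_id t).const_mul (-(2 * C))).exp
  have heac : AbsolutelyContinuousOnInterval e a b := by
    have hc : ContDiff ℝ 1 e := by fun_prop
    obtain ⟨K, hK⟩ := hc.locallyLipschitz.locallyLipschitzOn.exists_lipschitzOnWith_of_compact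
      (isCompact_uIcc (a := a) (b := b))
    exact hK.absolutelyContinuousOnInterval
  have hFTC := ((hw.fun_mul hw).fun_mul heac).integral_deriv_eq_sub
  have hle : (∫ t in a..b, deriv (fun t => w t * w t * e t) t) ≤ 0 := by
    rw [intervalIntegral.integral_of_le hab]
    refine integral_nonpos_of_ae ?_
    refine ae_restrict_of_ae_restrict_of_subset (t := Ioi a) (fun t ht => ht.1) ?_
    filter_upwards [h] with t ⟨d, hd, hdle⟩
    rw [show deriv (fun t => w t * w t * e t) t = _ from ((hd.mul hd).mul (hed t)).deriv]
    have := mul_le_mul_of_nonneg_left hdle (Real.exp_pos (-(2 * C) * t)).le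
    simp only [he, Pi.zero_apply, Pi.mul_apply]
    nlinarith
  rw [hFTC, hwa] at hle
  have hpos : 0 < e b := Real.exp_pos _
  have : w b * w b ≤ 0 := by
    by_contra! hcon
    nlinarith [mul_pos hcon hpos]
  exact mul_self_eq_zero.1 (le_antisymm this (mul_self_nonneg _))

namespace HasSideLimits

variable {U Um Up : ℝ → ℝ → ℝ}

lemma abs_left_le (hlim : HasSideLimits U Um Up) {M : ℝ} (hM : ∀ x t, |U x t| ≤ M) {x t : ℝ}
    (ht : 0 < t) : |Um x t| ≤ M :=
  le_of_tendsto (hlim.left x t ht).abs (Eventually.of_forall fun _ => hM _ _)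

lemma abs_right_le (hlim : HasSideLimits U Um Up) {M : ℝ} (hM : ∀ x t, |U x t| ≤ M) {x t : ℝ}
    (ht : 0 < t) : |Up x t| ≤ M :=
  le_of_tendsto (hlim.right x t ht).abs (Eventually.of_forall fun _ => hM _ _)

lemma left_sub_right_le (hlim : HasSideLimits U Um Up) {x y t c : ℝ} (ht : 0 < t) (hyx : y < x)
    (h : ∀ x y, y < x → U x t - U y t ≤ (x - y) / c) : Um x t - Up y t ≤ (x - y) / c := by
  have h1 : ∀ z, y < z → z < x → Um x t - U z t ≤ (x - z) / c := by
    intro z _ hzx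
    have hl : Tendsto (fun r => U r t - U z t) (𝓝[<] x) (𝓝 (Um x t - U z t)) :=
      (hlim.left x t ht).sub_const _
    have hr : Tendsto (fun r => (r - z) / c) (𝓝[<] x) (𝓝 ((x - z) / c)) :=
      ((continuous_id.sub continuous_const).div_const c).continuousAt.tendsto.mono_left
        nhdsWithin_le_nhds
    refine le_of_tendsto_of_tendsto hl hr ?_
    filter_upwards [Ioo_mem_nhdsLT hzx] with r hr
    exact h r z hr.1
  have hl : Tendsto (fun z => Um x t - U z t) (𝓝[>] y) (𝓝 (Um x t - Up y t)) :=
    (hlim.right y t ht).const_sub _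
  have hr : Tendsto (fun z => (x - z) / c) (𝓝[>] y) (𝓝 ((x - y) / c)) :=
    ((continuous_const.sub continuous_id).div_const c).continuousAt.tendsto.mono_left
      nhdsWithin_le_nhds
  refine le_of_tendsto_of_tendsto hl hr ?_
  filter_upwards [Ioo_mem_nhdsGT hyx] with z hz
  exact h1 z hz.1 hz.2

lemma apply_left_sub_apply_right_le (hlim : HasSideLimits U Um Up) {M α t₀ : ℝ}
    (hM : ∀ x t, |U x t| ≤ M) (hα : 0 < α) (ht₀ : 0 < t₀)
    (hO : ∀ x y t : ℝ, y < x → 0 < t → U x t - U y t ≤ (x - y) / (α * t))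
    {g : ℝ → ℝ} (hg : Monotone g) {K : NNReal} {r : ℝ} (hr : M ≤ r)
    (hK : LipschitzOnWith K g (Icc (-r) r)) {x y t : ℝ} (ht : t₀ < t) (hyx : y < x) :
    g (Um x t) - g (Up y t) ≤ K / (α * t₀) * (x - y) := by
  have htp : 0 < t := ht₀.trans ht
  have hxy : 0 < x - y := sub_pos.2 hyx
  rcases le_total (Um x t) (Up y t) with h | h
  · have := hg h
    have : 0 ≤ K / (α * t₀) * (x - y) := by positivity
    linarith
  · have h1 := hlim.left_sub_right_le htp hyx fun x y h => hO x y t h htp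
    have h2 := hK.dist_le_mul (Um x t)
      (abs_le.1 ((hlim.abs_left_le hM htp).trans hr)) (Up y t)
      (abs_le.1 ((hlim.abs_right_le hM htp).trans hr))
    rw [Real.dist_eq, Real.dist_eq, abs_of_nonneg (sub_nonneg.2 h)] at h2
    have h3 : (x - y) / (α * t) ≤ (x - y) / (α * t₀) := by gcongr
    calc g (Um x t) - g (Up y t) ≤ K * (Um x t - Up y t) := (le_abs_self _).trans h2
      _ ≤ K * ((x - y) / (α * t₀)) := by gcongr; exact h1.trans h3
      _ = K / (α * t₀) * (x - y) := by ring

end HasSideLimits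

/-- **Proposition A.1 (Filippov solutions for conservation laws).** If the set-valued map
`(x, t) ↦ [U(x+, t), U(x-, t)]` is upper semicontinuous and `g` is continuous and
non-decreasing, then for every `(x₀, t₀)` there is a Lipschitz Filippov solution of
`ẋ(t) ∈ [g(U(x(t)+, t)), g(U(x(t)-, t))]` with `x(t₀) = x₀`; moreover if `t₀ > 0`, `g` is
Lipschitz on bounded sets and `U` satisfies the Oleinik one-sided estimate, the solution
is unique. -/
theorem filippov_existence_uniqueness
    (A : ℝ → ℝ) (hA : ContDiff ℝ (⊤ : ℕ∞) A) (hA'' : ∀ x, 0 < deriv (deriv A) x)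
    (U0 : ℝ → ℝ) (hU0bd : ∃ M, ∀ x, |U0 x| ≤ M)
    (U Um Up : ℝ → ℝ → ℝ)
    (hsol : IsEntropySol A U) (hlim : HasSideLimits U Um Up)
    (hinit : ∀ x, U x 0 = U0 x) (hcont : L1locCont U)
    (husc : ∀ x t : ℝ, 0 < t → ∀ ε : ℝ, 0 < ε → ∃ δ : ℝ, 0 < δ ∧
      ∀ y s : ℝ, 0 < s → |y - x| < δ → |s - t| < δ →
        Icc (Up y s) (Um y s) ⊆ Icc (Up x t - ε) (Um x t + ε))
    (g : ℝ → ℝ) (hg : Continuous g) (hgmono : Monotone g) :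
    ∀ x₀ t₀ : ℝ, 0 ≤ t₀ →
      (∃ x : ℝ → ℝ, (∃ K : NNReal, LipschitzOnWith K x (Ici t₀)) ∧ x t₀ = x₀ ∧
        ∀ᵐ t ∂(volume.restrict (Ioi t₀)), ∃ d, HasDerivAt x d t ∧
          g (Up (x t) t) ≤ d ∧ d ≤ g (Um (x t) t)) ∧
      (0 < t₀ →
        (∀ r : ℝ, 0 < r → ∃ K : NNReal, LipschitzOnWith K g (Icc (-r) r)) →
        ∀ α : ℝ, 0 < α → (∀ ξ : ℝ, α ≤ deriv (deriv A) ξ) →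
        (∀ x y t : ℝ, y < x → 0 < t → U x t - U y t ≤ (x - y) / (α * t)) →
        ∀ x₁ x₂ : ℝ → ℝ,
          ((∃ K : NNReal, LipschitzOnWith K x₁ (Ici t₀)) ∧ x₁ t₀ = x₀ ∧
            ∀ᵐ t ∂(volume.restrict (Ioi t₀)), ∃ d, HasDerivAt x₁ d t ∧
              g (Up (x₁ t) t) ≤ d ∧ d ≤ g (Um (x₁ t) t)) →
          ((∃ K : NNReal, LipschitzOnWith K x₂ (Ici t₀)) ∧ x₂ t₀ = x₀ ∧
            ∀ᵐ t ∂(volume.restrict (Ioi t₀)), ∃ d, HasDerivAt x₂ d t ∧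
              g (Up (x₂ t) t) ≤ d ∧ d ≤ g (Um (x₂ t) t)) →
          EqOn x₁ x₂ (Ici t₀)) := by
  obtain ⟨M, hM⟩ := hsol.bounded
  intro x₀ t₀ ht₀
  constructor
  · obtain ⟨L, hL⟩ := (isCompact_Icc (a := -M) (b := M)).exists_bound_of_continuousOn
      hg.continuousOn
    have hM0 : 0 ≤ M := (abs_nonneg _).trans (hM 0 0)
    have hL0 : 0 ≤ L := (norm_nonneg _).trans (hL 0 ⟨by linarith, hM0⟩)
    refine exists_lipschitz_solution_of_selection (L := L)
      (v := fun y s => if 0 < s then g (Um y s) else 0)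
      (lo := fun y s => g (Up y s)) (hi := fun y s => g (Um y s)) ?_ ?_ x₀ t₀ ht₀
    · intro y s
      by_cases hs : 0 < s
      · simpa [hs] using hL _ (abs_le.1 (hlim.abs_left_le hM hs))
      · simpa [hs] using hL0
    · intro y t ht ε hε
      obtain ⟨η₁, hη₁, h₁⟩ := Metric.continuousAt_iff.1 (hg.continuousAt (x := Up y t)) ε hε
      obtain ⟨η₂, hη₂, h₂⟩ := Metric.continuousAt_iff.1 (hg.continuousAt (x := Um y t)) ε hε
      have hη : 0 < min η₁ η₂ / 2 := by positivity
      have hη₁' : min η₁ η₂ / 2 < η₁ := by linarith [min_le_left η₁ η₂]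
      have hη₂' : min η₁ η₂ / 2 < η₂ := by linarith [min_le_right η₁ η₂]
      obtain ⟨δ, hδ, hsub⟩ := husc y t ht _ hη
      refine ⟨δ, hδ, fun z s hs hz hst => ?_⟩
      have hmem := hsub z s hs hz hst (right_mem_Icc.2 (hlim.mono z s hs))
      have h3 := h₁ (x := Up y t - min η₁ η₂ / 2)
        (by rwa [Real.dist_eq, sub_sub_cancel_left, abs_neg, abs_of_pos hη])
      have h4 := h₂ (x := Um y t + min η₁ η₂ / 2)
        (by rwa [Real.dist_eq, add_sub_cancel_left, abs_of_pos hη])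
      rw [Real.dist_eq, abs_lt] at h3 h4
      have h5 := hgmono hmem.1
      have h6 := hgmono hmem.2
      simp only [hs, if_true]
      constructor <;> linarith
  · intro ht₀pos hgLip α hα _ hO x₁ x₂ ⟨⟨K₁, hK₁⟩, hx₁, hd₁⟩ ⟨⟨K₂, hK₂⟩, hx₂, hd₂⟩ b hb
    obtain ⟨K, hK⟩ := hgLip (max M 1) (lt_max_of_lt_right one_pos)
    have key := fun x y t => hlim.apply_left_sub_apply_right_le (x := x) (y := y) (t := t)
      hM hα ht₀pos hO hgmono (le_max_left M 1) hK
    have hsub : uIcc t₀ b ⊆ Ici t₀ := by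
      rw [uIcc_of_le hb]
      exact Icc_subset_Ici_self
    have hw := (hK₁.mono hsub).absolutelyContinuousOnInterval.sub
      (hK₂.mono hsub).absolutelyContinuousOnInterval
    have hw0 : (x₁ - x₂) t₀ = 0 := by simp [hx₁, hx₂]
    suffices h : (x₁ - x₂) b = 0 from sub_eq_zero.1 h
    refine hw.eq_zero_of_mul_deriv_le (C := K / (α * t₀)) hb hw0 ?_
    filter_upwards [hd₁, hd₂, ae_restrict_mem measurableSet_Ioi]
      with t ⟨d₁, hd₁, hlo₁, hhi₁⟩ ⟨d₂, hd₂, hlo₂, hhi₂⟩ ht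
    refine ⟨d₁ - d₂, hd₁.sub hd₂, ?_⟩
    simp only [Pi.sub_apply]
    rcases lt_trichotomy (x₁ t) (x₂ t) with h | h | h
    · have h1 : d₂ - d₁ ≤ K / (α * t₀) * (x₂ t - x₁ t) := by linarith [key _ _ t ht h]
      have := mul_le_mul_of_nonneg_left h1 (sub_nonneg.2 h.le)
      linarith
    · simp [h]
    · have h1 : d₁ - d₂ ≤ K / (α * t₀) * (x₁ t - x₂ t) := by linarith [key _ _ t ht h]
      have := mul_le_mul_of_nonneg_left h1 (sub_nonneg.2 h.le)
      linarith
end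
end
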